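/- arXiv:2009.00298 — 11 statements merged into one kernel-verified Lean document; each statement's English description precedes it below -/
import Mathlib

section
/- Let θ ∈ ℝ, n ∈ ℕ, let Y = !![0, -i; i, 0] and Z = !![1, 0; 0, -1] be the Pauli-Y and Pauli-Z matrices in Matrix (Fin 2) (Fin 2) ℂ, and let V = exp(-(π * θ) • (i • Y)) (matrix exponential). Then the (0,0) entry of (V^n)ᴴ * Z * V^n equals cos(2 * π * n * θ) (as a complex number). -/
open Matrix

lemma diag_two_aux (d : Fin 2 → ℂ) : diagonal d = !![d 0, 0; 0, d 1] := by
  ext i j; fin_cases i <;> fin_cases j <;> simp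

lemma exp_rot_aux (t : ℂ) : NormedSpace.exp (!![0, -t; t, 0] : Matrix (Fin 2) (Fin 2) ℂ)
    = !![Complex.cos t, -Complex.sin t; Complex.sin t, Complex.cos t] := by
  have hI := Complex.I_mul_I
  let U : (Matrix (Fin 2) (Fin 2) ℂ)ˣ :=
    ⟨!![1, 1; -Complex.I, Complex.I], !![1/2, Complex.I/2; 1/2, -Complex.I/2],
      by ext i j; fin_cases i <;> fin_cases j <;> simp [Matrix.mul_apply] <;> grind,
      by ext i j; fin_cases i <;> fin_cases j <;> simp [Matrix.mul_apply] <;> grind⟩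
  have h : (!![0, -t; t, 0] : Matrix (Fin 2) (Fin 2) ℂ)
      = (U : Matrix (Fin 2) (Fin 2) ℂ) * diagonal ![t * Complex.I, -t * Complex.I]
        * ((U⁻¹ : (Matrix (Fin 2) (Fin 2) ℂ)ˣ) : Matrix (Fin 2) (Fin 2) ℂ) := by
    change _ = !![1, 1; -Complex.I, Complex.I] * diagonal ![t * Complex.I, -t * Complex.I] *
      !![1/2, Complex.I/2; 1/2, -Complex.I/2]
    rw [diag_two_aux]
    ext i j; fin_cases i <;> fin_cases j <;> simp [Matrix.mul_apply] <;> grind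
  rw [h, Matrix.exp_units_conj, Matrix.exp_diagonal]
  change !![1, 1; -Complex.I, Complex.I] * diagonal _ *
      !![1/2, Complex.I/2; 1/2, -Complex.I/2] = _
  rw [diag_two_aux]
  ext i j; fin_cases i <;> fin_cases j <;>
    simp [Matrix.mul_apply, Pi.coe_exp, ← Complex.exp_eq_exp_ℂ,
      Complex.cos, Complex.sin] <;> grind

/-- For `θ ∈ ℝ`, `n ∈ ℕ`, with `Y`, `Z` the Pauli-Y and Pauli-Z matrices and
`V = exp(-(π θ) • (i • Y))`, the `(0,0)` entry of `(V^n)ᴴ * Z * V^n` is `cos (2πnθ)`. -/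
theorem pauliY_rotation_iterated_expectation (θ : ℝ) (n : ℕ)
    (Y Z V : Matrix (Fin 2) (Fin 2) ℂ)
    (hY : Y = !![0, -Complex.I; Complex.I, 0])
    (hZ : Z = !![1, 0; 0, -1])
    (hV : V = NormedSpace.exp ((-(Real.pi * θ) : ℝ) • (Complex.I • Y))) :
    ((V ^ n)ᴴ * Z * V ^ n) 0 0 = (Real.cos (2 * Real.pi * n * θ) : ℂ) := by
  have h : n • ((-(Real.pi * θ) : ℝ) • (Complex.I • Y))
      = !![0, -((n * (Real.pi * θ) : ℝ) : ℂ); ((n * (Real.pi * θ) : ℝ) : ℂ), 0] := by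
    subst hY
    ext i j; fin_cases i <;> fin_cases j <;> simp
  rw [hV, ← Matrix.exp_nsmul, h, exp_rot_aux, hZ, show 2 * Real.pi * n * θ = 2 * (n * (Real.pi * θ)) by ring, Real.cos_two_mul',
    ← Complex.ofReal_cos, ← Complex.ofReal_sin]
  generalize (n * (Real.pi * θ) : ℝ) = s
  simp [Matrix.mul_apply, Matrix.conjTranspose_apply, -Complex.ofReal_cos, -Complex.ofReal_sin]
  ring
end

section
/- Fix integers d ≥ 1 and N ≥ d. Let P be a real polynomial in the variables x₁,…,x_d such that for every j ∈ {1,…,d} the degree of P in the variable x_j is at most (N + d − j)/d. Then there exists a family of real weights (w_α)_{α ∈ {0,1}^N} such that P(x) = Σ_{α ∈ {0,1}^N} w_α ψ_α(x) for all x ∈ ℝ^d. -/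
lemma aux_monomial (d N : ℕ) (hd : 0 < d) (k : Fin d → ℕ)
    (hk : ∀ j : Fin d, k j * d + (j.val + 1) ≤ N + d) (y : Fin d → ℝ) :
    ∏ i : Fin N, (y ⟨i.val % d, Nat.mod_lt _ hd⟩) ^
      (if (decide (i.val / d < k ⟨i.val % d, Nat.mod_lt _ hd⟩)) then 1 else 0)
      = ∏ j, y j ^ k j := by
  rw [← Finset.prod_fiberwise (s := Finset.univ)
    (g := fun i : Fin N => (⟨i.val % d, Nat.mod_lt _ hd⟩ : Fin d))]
  refine Finset.prod_congr rfl fun j _ => ?_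
  have h1 : ∀ i ∈ Finset.univ.filter
      (fun i : Fin N => (⟨i.val % d, Nat.mod_lt _ hd⟩ : Fin d) = j),
      (y ⟨i.val % d, Nat.mod_lt _ hd⟩) ^
      (if (decide (i.val / d < k ⟨i.val % d, Nat.mod_lt _ hd⟩)) then 1 else 0)
      = y j ^ (if i.val / d < k j then 1 else 0) := by
    intro i hi
    rw [Finset.mem_filter] at hi
    rw [hi.2]
    simp
  rw [Finset.prod_congr rfl h1, Finset.prod_pow_eq_pow_sum, ← Finset.card_filter]
  congr 1
  rw [← Finset.card_range (k j)]
  refine Finset.card_bij' (fun i _ => i.val / d)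
    (fun t ht => (⟨t * d + j.val, ?_⟩ : Fin N)) ?_ ?_ ?_ ?_
  · have := hk j
    have h2 : (t + 1) * d ≤ k j * d := Nat.mul_le_mul_right _ (Finset.mem_range.1 ht)
    rw [Nat.add_mul] at h2
    omega
  · intro i hi
    simp at hi ⊢
    exact hi.2
  · intro t ht
    have hj := j.isLt
    simp at ht ⊢
    refine ⟨Fin.ext ?_, ?_⟩
    · simp [Nat.mod_eq_of_lt hj]
    · rw [add_comm, Nat.add_mul_div_right _ _ hd, Nat.div_eq_of_lt hj]; omega
  · intro i hi
    simp at hi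
    apply Fin.ext
    have := congrArg Fin.val hi.1
    simp at this
    have h3 := Nat.div_add_mod' i.val d
    simp
    omega
  · intro t ht
    have hj := j.isLt
    simp only
    rw [add_comm, Nat.add_mul_div_right _ _ hd, Nat.div_eq_of_lt hj]; omega

/-- Lemma S1: any real polynomial `P` in `d` variables whose degree in the variable `x_j`
is at most `(N + d - j)/d` (for `j = 1, …, d`, with `d ≤ N`) is a linear combination of the
basis functions `ψ_α(x) = ∏_{i=1}^N (2 x_{[i]} - 1)^{α_i}`, `α ∈ {0,1}^N`, where `[i]` is the
residue of `i` modulo `d` in `{1, …, d}`. -/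
theorem parallel_basis_spans_polynomials (d N : ℕ) (hd : 0 < d) (hN : d ≤ N)
    (P : MvPolynomial (Fin d) ℝ)
    (hdeg : ∀ j : Fin d,
      (P.degreeOf j : ℝ) ≤ ((N : ℝ) + ((d - (j.val + 1) : ℕ) : ℝ)) / d) :
    ∃ w : (Fin N → Bool) → ℝ, ∀ x : Fin d → ℝ,
      MvPolynomial.eval x P =
        ∑ α : Fin N → Bool, w α *
          ∏ i : Fin N,
            (2 * x ⟨i.val % d, Nat.mod_lt _ hd⟩ - 1) ^ (if α i then 1 else 0) := by
  classical
  let ψ : (Fin N → Bool) → (Fin d → ℝ) → ℝ := fun α x =>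
    ∏ i : Fin N, (2 * x ⟨i.val % d, Nat.mod_lt _ hd⟩ - 1) ^ (if α i then 1 else 0)
  suffices h : (fun x => MvPolynomial.eval x P) ∈ Submodule.span ℝ (Set.range ψ) by
    obtain ⟨w, hw⟩ := (Submodule.mem_span_range_iff_exists_fun ℝ).1 h
    refine ⟨w, fun x => ?_⟩
    have := congrFun hw x
    simp only [Finset.sum_apply, Pi.smul_apply, smul_eq_mul] at this
    exact this.symm
  have hdeg2 : ∀ j : Fin d, P.degreeOf j * d + (j.val + 1) ≤ N + d := by
    intro j
    have h := hdeg j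
    rw [le_div_iff₀ (by exact_mod_cast hd)] at h
    have h' : P.degreeOf j * d ≤ N + (d - (j.val + 1)) := by exact_mod_cast h
    have := j.isLt
    omega
  have e : (fun x => MvPolynomial.eval x P) =
      ∑ m ∈ P.support, P.coeff m • (fun x : Fin d → ℝ => ∏ j, x j ^ m j) := by
    funext x
    rw [MvPolynomial.eval_eq']
    simp [Finset.sum_apply]
  rw [e]
  refine Submodule.sum_mem _ fun m hm => Submodule.smul_mem _ _ ?_
  have e2 : (fun x : Fin d → ℝ => ∏ j, x j ^ m j) =
      ∑ k ∈ Fintype.piFinset (fun j => Finset.range (m j + 1)),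
        (∏ j, ((m j).choose (k j) : ℝ) / 2 ^ m j) •
          (fun x : Fin d → ℝ => ∏ j, (2 * x j - 1) ^ k j) := by
    funext x
    simp only [Finset.sum_apply, Pi.smul_apply, smul_eq_mul]
    simp_rw [← Finset.prod_mul_distrib]
    rw [← Finset.prod_univ_sum (fun j => Finset.range (m j + 1))
      (fun j k => ((m j).choose k : ℝ) / 2 ^ m j * (2 * x j - 1) ^ k)]
    refine Finset.prod_congr rfl fun j _ => ?_
    have h1 : x j = ((2 * x j - 1) + 1) / 2 := by ring
    conv_lhs => rw [h1, div_pow, add_pow, Finset.sum_div]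
    refine Finset.sum_congr rfl fun k _ => ?_
    rw [one_pow]
    ring
  rw [e2]
  refine Submodule.sum_mem _ fun k hk => Submodule.smul_mem _ _ (Submodule.subset_span ?_)
  refine ⟨fun i => decide (i.val / d < k ⟨i.val % d, Nat.mod_lt _ hd⟩), ?_⟩
  funext x
  refine aux_monomial d N hd k (fun j => ?_) (fun j => 2 * x j - 1)
  have h1 : k j ≤ m j := by
    have := Fintype.mem_piFinset.1 hk j
    rw [Finset.mem_range] at this
    omega
  have h2 : m j ≤ P.degreeOf j := MvPolynomial.le_degreeOf_of_mem_support j hm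
  have h3 := Nat.mul_le_mul_right d (h1.trans h2)
  have := hdeg2 j
  omega
end

section
/- Let d ≥ 1, let X be a compact subset of [0,1]^d, and let g : X → ℝ be continuous. Then for every ε > 0 there exist an integer N ≥ d and a family of real weights (w_α)_{α ∈ {0,1}^N} such that |Σ_{α ∈ {0,1}^N} w_α ψ_α(x) − g(x)| < ε for all x ∈ X. -/
noncomputable def pcoord (d : ℕ) (hd : 0 < d) (X : Set (Fin d → ℝ)) (i : ℕ) : C(X, ℝ) :=
  ⟨fun x => 2 * x.1 ⟨i % d, Nat.mod_lt _ hd⟩ - 1, ((continuous_const.mul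
    ((continuous_apply (⟨i % d, Nat.mod_lt _ hd⟩ : Fin d)).comp continuous_subtype_val)).sub
      continuous_const)⟩

noncomputable def ppsi (d : ℕ) (hd : 0 < d) (X : Set (Fin d → ℝ)) (N : ℕ) (a : ℕ → Bool) :
    C(X, ℝ) :=
  ∏ i ∈ Finset.range N, pcoord d hd X i ^ (if a i then 1 else 0)

noncomputable def pspan (d : ℕ) (hd : 0 < d) (X : Set (Fin d → ℝ)) (M : ℕ) :
    Submodule ℝ C(X, ℝ) :=
  Submodule.span ℝ (Set.range (ppsi d hd X (d * M)))

lemma ppsi_mul (d : ℕ) (hd : 0 < d) (X : Set (Fin d → ℝ)) (M M' : ℕ) (a b : ℕ → Bool) :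
    ppsi d hd X (d * M) a * ppsi d hd X (d * M') b =
      ppsi d hd X (d * (M + M')) (fun i => if i < d * M then a i else b (i - d * M)) := by
  unfold ppsi
  rw [mul_add, Finset.prod_range_add]
  congr 1
  · refine Finset.prod_congr rfl fun i hi => ?_
    simp [Finset.mem_range.1 hi]
  · refine Finset.prod_congr rfl fun i hi => ?_
    have : pcoord d hd X (d * M + i) = pcoord d hd X i := by
      ext x; simp [pcoord, Nat.mul_add_mod]
    simp [this]

lemma pspan_mul (d : ℕ) (hd : 0 < d) (X : Set (Fin d → ℝ)) (M M' : ℕ) {f g : C(X, ℝ)}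
    (hf : f ∈ pspan d hd X M) (hg : g ∈ pspan d hd X M') : f * g ∈ pspan d hd X (M + M') := by
  have h := Submodule.mul_mem_mul hf hg
  unfold pspan at h
  rw [Submodule.span_mul_span] at h
  refine Submodule.span_mono ?_ h
  rintro _ ⟨_, ⟨a, rfl⟩, _, ⟨b, rfl⟩, rfl⟩
  exact ⟨_, (ppsi_mul d hd X M M' a b).symm⟩

lemma pspan_one (d : ℕ) (hd : 0 < d) (X : Set (Fin d → ℝ)) (M : ℕ) :
    (1 : C(X, ℝ)) ∈ pspan d hd X M :=
  Submodule.subset_span ⟨fun _ => false, by simp [ppsi]⟩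

noncomputable def palg (d : ℕ) (hd : 0 < d) (X : Set (Fin d → ℝ)) : Subalgebra ℝ C(X, ℝ) where
  carrier := {f | ∃ M, f ∈ pspan d hd X M}
  mul_mem' := by
    rintro f g ⟨M, hf⟩ ⟨M', hg⟩
    exact ⟨_, pspan_mul d hd X M M' hf hg⟩
  add_mem' := by
    rintro f g ⟨M, hf⟩ ⟨M', hg⟩
    refine ⟨M + M', Submodule.add_mem _ ?_ ?_⟩
    · simpa using pspan_mul d hd X M M' hf (pspan_one d hd X M')
    · simpa using pspan_mul d hd X M M' (pspan_one d hd X M) hg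
  algebraMap_mem' r := by
    refine ⟨0, ?_⟩
    rw [Algebra.algebraMap_eq_smul_one]
    exact Submodule.smul_mem _ _ (pspan_one d hd X 0)

lemma palg_sep (d : ℕ) (hd : 0 < d) (X : Set (Fin d → ℝ)) : (palg d hd X).SeparatesPoints := by
  intro x y hxy
  obtain ⟨i, hi⟩ : ∃ i, x.1 i ≠ y.1 i := by
    by_contra! h
    exact hxy (Subtype.ext (funext h))
  refine ⟨pcoord d hd X i, ⟨pcoord d hd X i, ⟨1, Submodule.subset_span
    ⟨fun j => decide (j = i.1), ?_⟩⟩, rfl⟩, ?_⟩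
  · unfold ppsi
    rw [Finset.prod_eq_single i.1]
    · simp
    · intro b _ hb; simp [hb]
    · intro h; simp at h
  · simpa [pcoord, Nat.mod_eq_of_lt i.2] using hi

/-- Result 1 (UAP in the parallel scenario): for a compact `X ⊆ [0,1]^d` and a continuous
`g : X → ℝ`, for every `ε > 0` there are `N ≥ d` and weights `(w_α)_{α ∈ {0,1}^N}` with
`|∑_α w_α ψ_α(x) - g(x)| < ε` on `X`, where
`ψ_α(x) = ∏_{i=1}^N (2 x_{[i]} - 1)^{α_i}` and `[i]` is the residue of `i` mod `d` in
`{1, …, d}`. -/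
theorem parallel_scenario_UAP (d : ℕ) (hd : 0 < d) (X : Set (Fin d → ℝ))
    (hXc : IsCompact X) (hX : X ⊆ Set.Icc (0 : Fin d → ℝ) 1)
    (g : (Fin d → ℝ) → ℝ) (hg : ContinuousOn g X)
    (ε : ℝ) (hε : 0 < ε) :
    ∃ N : ℕ, d ≤ N ∧ ∃ w : (Fin N → Bool) → ℝ, ∀ x ∈ X,
      |(∑ α : Fin N → Bool, w α *
          ∏ i : Fin N,
            (2 * x ⟨i.val % d, Nat.mod_lt _ hd⟩ - 1) ^ (if α i then 1 else 0)) - g x| < ε := by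
  have : CompactSpace X := isCompact_iff_compactSpace.1 hXc
  obtain ⟨⟨f, M, hf⟩, hfg⟩ := ContinuousMap.exists_mem_subalgebra_near_continuous_of_separatesPoints
    (palg d hd X) (palg_sep d hd X) (X.domRestrict g) hg.domRestrict ε hε
  have hf' : f ∈ pspan d hd X (M + 1) := by
    simpa using pspan_mul d hd X M 1 hf (pspan_one d hd X 1)
  refine ⟨d * (M + 1), Nat.le_mul_of_pos_right _ (Nat.succ_pos _), ?_⟩
  have hle : pspan d hd X (M + 1) ≤ Submodule.span ℝ (Set.range
      (fun α : Fin (d * (M + 1)) → Bool =>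
        ∏ i : Fin (d * (M + 1)), pcoord d hd X i ^ (if α i then 1 else 0))) := by
    refine Submodule.span_mono ?_
    rintro _ ⟨a, rfl⟩
    refine ⟨fun i => a i, ?_⟩
    simp only [ppsi]
    exact Fin.prod_univ_eq_prod_range
      (fun i => pcoord d hd X i ^ (if a i then 1 else 0)) _
  obtain ⟨w, hw⟩ := (Submodule.mem_span_range_iff_exists_fun ℝ).1 (hle hf')
  refine ⟨w, fun x hx => ?_⟩
  have h1 := hfg ⟨x, hx⟩
  rw [Real.norm_eq_abs] at h1
  convert h1 using 3
  · simp only [← hw, ContinuousMap.coe_sum, Finset.sum_apply, ContinuousMap.coe_smul, Pi.smul_apply,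
      smul_eq_mul, ContinuousMap.coe_prod, Finset.prod_apply, ContinuousMap.coe_pow, Pi.pow_apply]
    rfl
  · rfl
end

section
/- Let a < b be real numbers and let θ : [a,b] → ℝ be continuous. Then there exist a continuous function g : [a,b] → ℝ and ε > 0 such that for every n ∈ ℕ and every w ∈ ℝ there exists x ∈ [a,b] with |w · cos(2π n θ(x)) − g(x)| ≥ ε. In other words, the family of functions x ↦ w cos(2π n θ(x)) (over all n ∈ ℕ and w ∈ ℝ) is not dense in C([a,b]) with respect to the supremum norm. -/
/-- The sequential scenario has no UAP on an interval: for any continuous `θ : [a,b] → ℝ`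
(`a < b`), there are a continuous `g : [a,b] → ℝ` and `ε > 0` such that every function
`x ↦ w·cos(2π n θ(x))` (`n ∈ ℕ`, `w ∈ ℝ`) is at sup-distance at least `ε` from `g`. -/
theorem sequential_scenario_no_UAP_on_interval (a b : ℝ) (hab : a < b)
    (θ : ℝ → ℝ) (hθ : ContinuousOn θ (Set.Icc a b)) :
    ∃ g : ℝ → ℝ, ContinuousOn g (Set.Icc a b) ∧ ∃ ε : ℝ, 0 < ε ∧
      ∀ (n : ℕ) (w : ℝ), ∃ x ∈ Set.Icc a b,
        ε ≤ |w * Real.cos (2 * Real.pi * n * θ x) - g x| := by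
  have hmid : (θ a + θ b) / 2 ∈ θ '' Set.Icc a b := by
    have h := intermediate_value_uIcc (a := a) (b := b) (f := θ)
      (by rwa [Set.uIcc_of_le hab.le])
    rw [Set.uIcc_of_le hab.le] at h
    apply h
    rw [Set.mem_uIcc]
    rcases le_total (θ a) (θ b) with h1 | h1
    · left; constructor <;> linarith
    · right; constructor <;> linarith
  obtain ⟨c, hc, hcθ⟩ := hmid
  refine ⟨fun x => |x - c|, by fun_prop, (b - a) / 4, by linarith, ?_⟩
  intro n w
  by_contra! hcon
  have ha := hcon a ⟨le_rfl, hab.le⟩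
  have hb := hcon b ⟨hab.le, le_rfl⟩
  have hm := hcon c hc
  have hga : |a - c| = c - a := by rw [abs_of_nonpos (by linarith [hc.1])]; ring
  have hgb : |b - c| = b - c := abs_of_nonneg (by linarith [hc.2])
  simp only [hga, hgb, sub_self, abs_zero, sub_zero] at ha hb hm
  have key : w * Real.cos (2 * Real.pi * n * θ a) + w * Real.cos (2 * Real.pi * n * θ b)
      = 2 * Real.cos (Real.pi * n * (θ a - θ b)) * (w * Real.cos (2 * Real.pi * n * θ c)) := by
    rw [← mul_add, Real.cos_add_cos, hcθ]
    have e1 : (2 * Real.pi * n * θ a + 2 * Real.pi * n * θ b) / 2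
        = 2 * Real.pi * n * ((θ a + θ b) / 2) := by ring
    have e2 : (2 * Real.pi * n * θ a - 2 * Real.pi * n * θ b) / 2
        = Real.pi * n * (θ a - θ b) := by ring
    rw [e1, e2]; ring
  have hk : |2 * Real.cos (Real.pi * n * (θ a - θ b)) * (w * Real.cos (2 * Real.pi * n * θ c))|
      ≤ 2 * |w * Real.cos (2 * Real.pi * n * θ c)| := by
    rw [abs_mul, abs_mul, abs_two]
    have := Real.abs_cos_le_one (Real.pi * n * (θ a - θ b))
    gcongr
    linarith
  rw [← key] at hk
  have h1 := le_abs_self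
    (w * Real.cos (2 * Real.pi * n * θ a) + w * Real.cos (2 * Real.pi * n * θ b))
  have h2 := (abs_lt.mp ha).1
  have h3 := (abs_lt.mp hb).1
  linarith
end

section
/- Let X = {x₁,…,x_M} be a finite set of M ≥ 1 distinct points in ℝ^d and let θ : X → ℝ be such that the real numbers 1, θ(x₁),…,θ(x_M) are linearly independent over ℚ. Then for every function g : X → ℝ and every ε > 0 there exist n ∈ ℕ and w ∈ ℝ such that |w · cos(2π n θ(x)) − g(x)| < ε for all x ∈ X. -/
open MeasureTheory Filter Topology UnitAddTorus

lemma mF_add {M : ℕ} (n : Fin M → ℤ) (x y : UnitAddTorus (Fin M)) :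
    mFourier n (x + y) = mFourier n x * mFourier n y := by
  simp [mFourier, ← Finset.prod_mul_distrib, fourier_apply, smul_add, AddCircle.toCircle_add]

lemma mF_nsmul {M : ℕ} (n : Fin M → ℤ) (x : UnitAddTorus (Fin M)) (k : ℕ) :
    mFourier n (k • x) = (mFourier n x) ^ k := by
  induction k with
  | zero => simp [mFourier]
  | succ k ih => rw [succ_nsmul, mF_add, ih, pow_succ]

lemma norm_mF {M : ℕ} (n : Fin M → ℤ) (x : UnitAddTorus (Fin M)) : ‖mFourier n x‖ = 1 := by
  simp only [mFourier, ContinuousMap.coe_mk, norm_prod, fourier_apply]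
  exact Finset.prod_eq_one fun i _ => Circle.norm_coe _

lemma avg_tendsto {M : ℕ} (θ : UnitAddTorus (Fin M))
    (hθ : ∀ n : Fin M → ℤ, n ≠ 0 → mFourier n θ ≠ 1)
    (μ : Measure (UnitAddTorus (Fin M))) [IsProbabilityMeasure μ] [μ.IsAddLeftInvariant]
    (p : C(UnitAddTorus (Fin M), ℂ)) (hp : p ∈ Submodule.span ℂ (Set.range mFourier)) :
    Tendsto (fun N : ℕ => (N : ℂ)⁻¹ * ∑ k ∈ Finset.range N, p (k • θ)) atTop
      (𝓝 (∫ t, p t ∂μ)) := by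
  have hint : ∀ f : C(UnitAddTorus (Fin M), ℂ), Integrable f μ := fun f =>
    f.continuous.integrable_of_hasCompactSupport (HasCompactSupport.of_compactSpace f)
  induction hp using Submodule.span_induction with
  | mem f hf =>
    obtain ⟨n, rfl⟩ := hf
    by_cases hn : n = 0
    · subst hn
      simp only [mFourier_zero, ContinuousMap.one_apply, integral_const, probReal_univ, one_smul]
      refine tendsto_const_nhds.congr' ?_
      filter_upwards [eventually_gt_atTop 0] with N hN
      have : (N : ℂ) ≠ 0 := by exact_mod_cast hN.ne'
      simp [this]
    · have h1 := hθ n hn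
      have hI : ∫ t, mFourier n t ∂μ = 0 := by
        have := integral_add_left_eq_self (μ := μ) (fun t => mFourier n t) θ
        simp only [mF_add, integral_const_mul] at this
        have h2 : (mFourier n θ - 1) * ∫ t, mFourier n t ∂μ = 0 := by rw [sub_mul, this]; ring
        exact (mul_eq_zero.1 h2).resolve_left (sub_ne_zero.2 h1)
      rw [hI]
      simp only [mF_nsmul, geom_sum_eq h1]
      have h0 : Tendsto (fun N : ℕ => 2 / ‖mFourier n θ - 1‖ * ((N : ℝ))⁻¹) atTop (𝓝 0) := by
        simpa using (tendsto_inv_atTop_nhds_zero_nat (𝕜 := ℝ)).const_mul (2 / ‖mFourier n θ - 1‖)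
      refine squeeze_zero_norm (fun N => ?_) h0
      rw [norm_mul, norm_div, norm_inv, mul_comm]
      simp only [RCLike.norm_natCast]
      gcongr
      calc _ ≤ ‖mFourier n θ ^ N‖ + ‖(1 : ℂ)‖ := norm_sub_le _ _
        _ = 2 := by rw [norm_pow, norm_mF]; norm_num
  | zero => simp
  | add f g _ _ hf hg =>
    simp only [ContinuousMap.add_apply, Finset.sum_add_distrib, mul_add]
    rw [integral_add (hint f) (hint g)]
    exact hf.add hg
  | smul c f _ hf =>
    simp only [ContinuousMap.smul_apply, smul_eq_mul, ← Finset.mul_sum]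
    rw [integral_const_mul]
    convert hf.const_mul c using 2
    ring

lemma kron {M : ℕ} (θ : UnitAddTorus (Fin M))
    (hθ : ∀ n : Fin M → ℤ, n ≠ 0 → mFourier n θ ≠ 1)
    (U : Set (UnitAddTorus (Fin M))) (hU : IsOpen U) (β : UnitAddTorus (Fin M)) (hβ : β ∈ U) :
    ∃ k : ℕ, k • θ ∈ U := by
  by_contra! hcon
  obtain ⟨δ, hδ, hball⟩ := Metric.isOpen_iff.1 hU β hβ
  let μ : Measure (UnitAddTorus (Fin M)) := Measure.pi fun _ => AddCircle.haarAddCircle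
  haveI : μ.IsAddHaarMeasure := by unfold μ; infer_instance
  haveI : IsProbabilityMeasure μ := by unfold μ; infer_instance
  let b : UnitAddTorus (Fin M) → ℝ := fun t => max 0 (δ - dist t β)
  have hb : Continuous b := by unfold b; fun_prop
  have hpos : 0 < ∫ t, b t ∂μ :=
    hb.integral_pos_of_hasCompactSupport_nonneg_nonzero (x := β)
      (HasCompactSupport.of_compactSpace b) (fun t => le_max_left _ _) (by simp [b, hδ.ne', hδ.le])
  set c := ∫ t, b t ∂μ with hc
  let f : C(UnitAddTorus (Fin M), ℂ) := ⟨fun t => (b t : ℂ), by fun_prop⟩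
  have hfc : ∫ t, f t ∂μ = (c : ℂ) := by
    simpa [f, hc] using integral_ofReal (μ := μ) (f := b) (𝕜 := ℂ)
  have hf0 : ∀ k : ℕ, f (k • θ) = 0 := by
    intro k
    have : ¬ dist (k • θ) β < δ := fun h => hcon k (hball h)
    simp only [f, b, ContinuousMap.coe_mk, Complex.ofReal_eq_zero]
    exact max_eq_left (by linarith)
  have hint : ∀ f : C(UnitAddTorus (Fin M), ℂ), Integrable f μ := fun f =>
    f.continuous.integrable_of_hasCompactSupport (HasCompactSupport.of_compactSpace f)
  have hmem : f ∈ (Submodule.span ℂ (Set.range (mFourier (d := Fin M)))).topologicalClosure := by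
    rw [span_mFourier_closure_eq_top]; trivial
  obtain ⟨p, hp, hpd⟩ := Metric.mem_closure_iff.1 hmem (c / 3) (by positivity)
  rw [dist_eq_norm] at hpd
  have hpt : ∀ t, ‖f t - p t‖ ≤ c / 3 := fun t => ((f - p).norm_coe_le_norm t).trans hpd.le
  have h1 : ‖∫ t, p t ∂μ‖ ≤ c / 3 := by
    refine le_of_tendsto (avg_tendsto θ hθ μ p hp).norm ?_
    filter_upwards [eventually_gt_atTop 0] with N hN
    have hN' : (0 : ℝ) < N := by exact_mod_cast hN
    have : ‖∑ k ∈ Finset.range N, p (k • θ)‖ ≤ N * (c / 3) := by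
      refine (norm_sum_le_of_le (f := fun k => p (k • θ)) (Finset.range N)
        (n := fun _ => c / 3) fun k _ => ?_).trans (by simp)
      simpa [hf0] using hpt (k • θ)
    rw [norm_mul, norm_inv, RCLike.norm_natCast, inv_mul_le_iff₀ hN']
    exact this
  have h2 : ‖(c : ℂ) - ∫ t, p t ∂μ‖ ≤ c / 3 := by
    rw [← hfc, ← integral_sub (hint f) (hint p)]
    simpa using norm_integral_le_of_norm_le_const (μ := μ) (Eventually.of_forall hpt)
  have h3 : ‖(c : ℂ)‖ ≤ c / 3 + c / 3 := by
    calc ‖(c : ℂ)‖ = ‖((c : ℂ) - ∫ t, p t ∂μ) + ∫ t, p t ∂μ‖ := by ring_nf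
      _ ≤ _ := (norm_add_le _ _).trans (add_le_add h2 h1)
  rw [Complex.norm_real, Real.norm_eq_abs, abs_of_pos hpos] at h3
  linarith

/-- Result 3 (UAP in the sequential scenario): if `X = {x₁, …, x_M} ⊆ ℝ^d` consists of `M`
distinct points and `1, θ(x₁), …, θ(x_M)` are linearly independent over `ℚ`, then every
function `g : X → ℝ` can be `ε`-approximated by `x ↦ w·cos(2π n θ(x))` for some `n ∈ ℕ`,
`w ∈ ℝ`. -/
theorem sequential_scenario_UAP (d M : ℕ) (hM : 1 ≤ M)
    (x : Fin M → (Fin d → ℝ)) (hx : Function.Injective x)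
    (θ : (Fin d → ℝ) → ℝ)
    (hlin : ∀ (c : ℤ) (α : Fin M → ℤ),
      (c : ℝ) + ∑ i, (α i : ℝ) * θ (x i) = 0 → c = 0 ∧ ∀ i, α i = 0)
    (g : (Fin d → ℝ) → ℝ) (ε : ℝ) (hε : 0 < ε) :
    ∃ (n : ℕ) (w : ℝ), ∀ i : Fin M,
      |w * Real.cos (2 * Real.pi * n * θ (x i)) - g (x i)| < ε := by
  have hfr : ∀ t : ℝ, (fourier 1 (t : UnitAddCircle)).re = Real.cos (2 * Real.pi * t) := by
    intro t
    rw [fourier_coe_apply]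
    have : (2 * Real.pi * Complex.I * (1 : ℤ) * t / (1 : ℝ) : ℂ)
        = ((2 * Real.pi * t : ℝ) : ℂ) * Complex.I := by push_cast; ring
    rw [this, Complex.exp_ofReal_mul_I_re]
  let τ : UnitAddTorus (Fin M) := fun i => ((θ (x i) : ℝ) : UnitAddCircle)
  have hτ : ∀ n : Fin M → ℤ, n ≠ 0 → mFourier n τ ≠ 1 := by
    intro n hn h
    apply hn
    simp only [mFourier, ContinuousMap.coe_mk, τ, fourier_coe_apply] at h
    rw [← Complex.exp_sum, Complex.exp_eq_one_iff] at h
    obtain ⟨m, hm⟩ := h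
    have h2 : (∑ i, (n i : ℂ) * (θ (x i) : ℂ)) = m := by
      have h3 : (2 * Real.pi * Complex.I : ℂ) ≠ 0 := Complex.two_pi_I_ne_zero
      apply mul_left_cancel₀ h3
      rw [Finset.mul_sum, mul_comm _ (m : ℂ), ← hm]
      refine Finset.sum_congr rfl fun i _ => ?_
      push_cast
      ring
    have h4 : (∑ i, (n i : ℝ) * θ (x i)) = m := by exact_mod_cast h2
    funext i
    exact (hlin (-m) n (by push_cast; rw [h4]; ring)).2 i
  let W : ℝ := 1 + ∑ i, |g (x i)|
  have hW : 0 < W := by unfold W; positivity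
  have hgW : ∀ i, |g (x i)| ≤ W := fun i => by
    have := Finset.single_le_sum (f := fun i => |g (x i)|) (fun i _ => abs_nonneg _)
      (Finset.mem_univ i)
    simp only [W]; linarith
  let U : Set (UnitAddTorus (Fin M)) :=
    {t | ∀ i, |W * (fourier 1 (t i) : ℂ).re - g (x i)| < ε}
  have hU : IsOpen U := by
    simp only [U, Set.setOf_forall]
    refine isOpen_iInter_of_finite fun i => isOpen_lt ?_ continuous_const
    have : Continuous fun t : UnitAddTorus (Fin M) => (fourier 1 (t i) : ℂ) :=
      (fourier 1).continuous.comp (continuous_apply i)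
    fun_prop
  let β : UnitAddTorus (Fin M) := fun i =>
    ((Real.arccos (g (x i) / W) / (2 * Real.pi) : ℝ) : UnitAddCircle)
  have hβ : β ∈ U := by
    intro i
    have h5 := abs_le.1 (hgW i)
    have : 2 * Real.pi * (Real.arccos (g (x i) / W) / (2 * Real.pi))
        = Real.arccos (g (x i) / W) := by field_simp
    simp only [β]
    rw [hfr, this, Real.cos_arccos (by rw [le_div_iff₀ hW]; linarith)
      (by rw [div_le_iff₀ hW]; linarith), mul_div_cancel₀ _ hW.ne']
    simpa using hε
  obtain ⟨k, hk⟩ := kron τ hτ U hU β hβ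
  refine ⟨k, W, fun i => ?_⟩
  have h6 := hk i
  have h7 : (k • τ) i = ((k * θ (x i) : ℝ) : UnitAddCircle) := by
    simp only [τ, Pi.smul_apply, ← AddCircle.coe_nsmul, nsmul_eq_mul]
  rw [h7, hfr, ← mul_assoc] at h6
  exact h6
end

section
/- Let d ≥ 1 and let a₁,…,a_d be real numbers such that 1, a₁,…,a_d are linearly independent over ℚ. Let f : ℝ^d → ℝ be continuous and ℤ^d-periodic, i.e. f(x + m) = f(x) for every x ∈ ℝ^d and every m ∈ ℤ^d. Then lim_{M → ∞} (1/M) Σ_{n=1}^{M} f(n a₁, …, n a_d) = ∫_{[0,1]^d} f(x) dx, where the integral is with respect to Lebesgue measure on [0,1]^d. -/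
open MeasureTheory

theorem wz (d : ℕ) (a : Fin d → ℝ) (k : Fin d → ℤ) (n : ℕ) :
    UnitAddTorus.mFourier k (fun i => (((n : ℝ) * a i : ℝ) : UnitAddCircle)) =
      (Complex.exp (2 * Real.pi * Complex.I * ((∑ i, (k i : ℝ) * a i : ℝ) : ℂ))) ^ n := by
  simp only [UnitAddTorus.mFourier, ContinuousMap.coe_mk, fourier_coe_apply]
  rw [← Complex.exp_sum, ← Complex.exp_nat_mul]
  congr 1
  push_cast
  rw [Finset.mul_sum, Finset.mul_sum]
  refine Finset.sum_congr rfl fun i _ => ?_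
  ring

theorem wgeom (z : ℂ) (hz : z ≠ 1) (hn : ‖z‖ = 1) :
    Filter.Tendsto (fun M : ℕ => (1 / (M : ℂ)) * ∑ n ∈ Finset.Icc 1 M, z ^ n)
      Filter.atTop (nhds 0) := by
  have hz1 : 0 < ‖z - 1‖ := norm_pos_iff.2 (sub_ne_zero.2 hz)
  have hb : ∀ M : ℕ, ‖∑ n ∈ Finset.Icc 1 M, z ^ n‖ ≤ 2 / ‖z - 1‖ := by
    intro M
    rw [le_div_iff₀ hz1, ← norm_mul]
    have : (∑ n ∈ Finset.Icc 1 M, z ^ n) * (z - 1) = z ^ (M + 1) - z := by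
      induction M with
      | zero => simp
      | succ m ih =>
        rw [Finset.sum_Icc_succ_top (by omega), add_mul, ih]; ring
    rw [this]
    refine (norm_sub_le _ _).trans ?_
    rw [norm_pow, hn]; norm_num
  refine squeeze_zero_norm (a := fun M : ℕ => (2 / ‖z - 1‖) / (M : ℝ)) ?_
    (tendsto_const_div_atTop_nhds_zero_nat _)
  intro M
  rw [norm_mul, norm_div, norm_one, Complex.norm_natCast, div_mul_eq_mul_div, one_mul]
  gcongr
  exact hb M

theorem wint1 (k : ℤ) (hk : k ≠ 0) :
    ∫ x in Set.Icc (0 : ℝ) 1, fourier k (x : UnitAddCircle) = 0 := by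
  rw [integral_Icc_eq_integral_Ioc, ← intervalIntegral.integral_of_le zero_le_one]
  simp only [fourier_coe_apply]
  have hc : (2 * Real.pi * Complex.I * k : ℂ) ≠ 0 := by
    simp [Real.pi_ne_zero, hk]
  have := integral_exp_mul_complex (a := 0) (b := 1) hc
  simp only [Complex.ofReal_one, div_one]
  rw [this]
  have h1 : Complex.exp (2 * Real.pi * Complex.I * k * ((1 : ℝ) : ℂ)) = 1 := by
    rw [Complex.exp_eq_one_iff]
    exact ⟨k, by push_cast; ring⟩
  rw [h1]; simp

theorem wint (d : ℕ) (k : Fin d → ℤ) (hk : k ≠ 0) :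
    ∫ x in Set.Icc (0 : Fin d → ℝ) 1,
      UnitAddTorus.mFourier k (fun i => ((x i : ℝ) : UnitAddCircle)) = 0 := by
  obtain ⟨j, hj⟩ := Function.ne_iff.1 hk
  rw [← Set.pi_univ_Icc, volume_pi, Measure.restrict_pi_pi]
  simp only [UnitAddTorus.mFourier, ContinuousMap.coe_mk]
  rw [integral_fintype_prod_eq_prod (𝕜 := ℂ)
    (fun i (x : ℝ) => fourier (k i) (x : UnitAddCircle))]
  exact Finset.prod_eq_zero (Finset.mem_univ j) (wint1 _ hj)

theorem wvol (d : ℕ) : volume.real (Set.Icc (0 : Fin d → ℝ) 1) = 1 := by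
  simp [Measure.real, Real.volume_Icc_pi]

theorem wcont (d : ℕ) (g : C(UnitAddTorus (Fin d), ℂ)) :
    Continuous (fun x : Fin d → ℝ => g (fun i => ((x i : ℝ) : UnitAddCircle))) := by
  refine g.continuous.comp (continuous_pi fun i => ?_)
  exact (AddCircle.continuous_mk' 1).comp (continuous_apply i)

theorem wintegrable (d : ℕ) (g : C(UnitAddTorus (Fin d), ℂ)) :
    IntegrableOn (fun x : Fin d → ℝ => g (fun i => ((x i : ℝ) : UnitAddCircle)))
      (Set.Icc 0 1) :=
  (wcont d g).continuousOn.integrableOn_compact isCompact_Icc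

theorem wspan (d : ℕ) (a : Fin d → ℝ)
    (hlin : ∀ (c : ℤ) (α : Fin d → ℤ),
      (c : ℝ) + ∑ i, (α i : ℝ) * a i = 0 → c = 0 ∧ ∀ i, α i = 0)
    (g : C(UnitAddTorus (Fin d), ℂ))
    (hg : g ∈ Submodule.span ℂ (Set.range (UnitAddTorus.mFourier (d := Fin d)))) :
    Filter.Tendsto (fun M : ℕ => (1 / (M : ℂ)) * ∑ n ∈ Finset.Icc 1 M,
        g (fun i => (((n : ℝ) * a i : ℝ) : UnitAddCircle)))
      Filter.atTop (nhds (∫ x in Set.Icc (0 : Fin d → ℝ) 1,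
        g (fun i => ((x i : ℝ) : UnitAddCircle)))) := by
  induction hg using Submodule.span_induction with
  | mem g hg =>
    obtain ⟨k, rfl⟩ := hg
    by_cases hk : k = 0
    · subst hk
      simp only [UnitAddTorus.mFourier_zero, ContinuousMap.one_apply]
      rw [setIntegral_const, wvol]
      refine tendsto_const_nhds.congr' ?_
      filter_upwards [Filter.eventually_ge_atTop 1] with M hM
      have : (M : ℂ) ≠ 0 := by exact_mod_cast (by omega : M ≠ 0)
      simp [this]
    · rw [wint d k hk]
      simp only [wz]
      refine wgeom _ ?_ ?_
      · intro h
        rw [Complex.exp_eq_one_iff] at h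
        obtain ⟨m, hm⟩ := h
        have h2 : (2 * Real.pi * Complex.I : ℂ) ≠ 0 := Complex.two_pi_I_ne_zero
        rw [mul_comm (m : ℂ)] at hm
        have h3 := mul_left_cancel₀ h2 hm
        have h4 : ∑ i, (k i : ℝ) * a i = m := by exact_mod_cast h3
        have h5 := hlin (-m) k (by rw [h4]; push_cast; ring)
        exact hk (funext h5.2)
      · rw [Complex.norm_exp]
        simp
  | zero => simp
  | add g h _ _ ihg ihh =>
    simp only [ContinuousMap.add_apply]
    rw [integral_add (wintegrable d g) (wintegrable d h)]
    refine (ihg.add ihh).congr fun M => ?_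
    rw [Finset.sum_add_distrib, mul_add]
  | smul c g _ ih =>
    simp only [ContinuousMap.smul_apply]
    rw [integral_smul]
    refine (ih.const_smul c).congr fun M => ?_
    rw [← Finset.smul_sum, mul_smul_comm]

theorem wall (d : ℕ) (a : Fin d → ℝ)
    (hlin : ∀ (c : ℤ) (α : Fin d → ℤ),
      (c : ℝ) + ∑ i, (α i : ℝ) * a i = 0 → c = 0 ∧ ∀ i, α i = 0)
    (g : C(UnitAddTorus (Fin d), ℂ)) :
    Filter.Tendsto (fun M : ℕ => (1 / (M : ℂ)) * ∑ n ∈ Finset.Icc 1 M,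
        g (fun i => (((n : ℝ) * a i : ℝ) : UnitAddCircle)))
      Filter.atTop (nhds (∫ x in Set.Icc (0 : Fin d → ℝ) 1,
        g (fun i => ((x i : ℝ) : UnitAddCircle)))) := by
  have hg : g ∈ (Submodule.span ℂ (Set.range
      (UnitAddTorus.mFourier (d := Fin d)))).topologicalClosure := by
    rw [UnitAddTorus.span_mFourier_closure_eq_top]; trivial
  rw [← SetLike.mem_coe, Submodule.topologicalClosure_coe, Metric.mem_closure_iff] at hg
  rw [Metric.tendsto_atTop]
  intro ε hε
  obtain ⟨p, hp, hgp⟩ := hg (ε / 3) (by positivity)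
  obtain ⟨N, hN⟩ := Metric.tendsto_atTop.1 (wspan d a hlin p hp) (ε / 3) (by positivity)
  have hpt : ∀ t, ‖g t - p t‖ ≤ ε / 3 := fun t => by
    rw [← dist_eq_norm]; exact (ContinuousMap.dist_apply_le_dist t).trans hgp.le
  have hI : dist (∫ x in Set.Icc (0 : Fin d → ℝ) 1, p (fun i => ((x i : ℝ) : UnitAddCircle)))
      (∫ x in Set.Icc (0 : Fin d → ℝ) 1, g (fun i => ((x i : ℝ) : UnitAddCircle))) ≤ ε / 3 := by
    rw [dist_comm, dist_eq_norm, ← integral_sub (wintegrable d g) (wintegrable d p)]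
    refine (norm_setIntegral_le_of_norm_le_const (C := ε / 3) ?_ ?_).trans ?_
    · exact isCompact_Icc.measure_lt_top
    · intro x _; exact hpt _
    · rw [wvol, mul_one]
  refine ⟨N, fun M hM => ?_⟩
  have hA : dist ((1 / (M : ℂ)) * ∑ n ∈ Finset.Icc 1 M,
        g (fun i => (((n : ℝ) * a i : ℝ) : UnitAddCircle)))
      ((1 / (M : ℂ)) * ∑ n ∈ Finset.Icc 1 M,
        p (fun i => (((n : ℝ) * a i : ℝ) : UnitAddCircle))) ≤ ε / 3 := by
    rw [dist_eq_norm, ← mul_sub, ← Finset.sum_sub_distrib, norm_mul, norm_div, norm_one,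
      Complex.norm_natCast]
    have h1 : ‖∑ n ∈ Finset.Icc 1 M, (g (fun i => (((n : ℝ) * a i : ℝ) : UnitAddCircle)) -
        p (fun i => (((n : ℝ) * a i : ℝ) : UnitAddCircle)))‖ ≤ M * (ε / 3) := by
      refine (norm_sum_le_of_le _ fun n _ => hpt _).trans ?_
      simp
    rcases Nat.eq_zero_or_pos M with h0 | h0
    · subst h0; simp; positivity
    · have : (0 : ℝ) < M := by exact_mod_cast h0
      rw [one_div, inv_mul_le_iff₀ this]
      exact h1
  have := hN M hM
  have t1 := dist_triangle4 ((1 / (M : ℂ)) * ∑ n ∈ Finset.Icc 1 M,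
        g (fun i => (((n : ℝ) * a i : ℝ) : UnitAddCircle))) ((1 / (M : ℂ)) * ∑ n ∈ Finset.Icc 1 M,
        p (fun i => (((n : ℝ) * a i : ℝ) : UnitAddCircle)))
        (∫ x in Set.Icc (0 : Fin d → ℝ) 1, p (fun i => ((x i : ℝ) : UnitAddCircle)))
        (∫ x in Set.Icc (0 : Fin d → ℝ) 1, g (fun i => ((x i : ℝ) : UnitAddCircle)))
  linarith

theorem wlift (d : ℕ) (f : (Fin d → ℝ) → ℝ) (hf : Continuous f)
    (hper : ∀ (x : Fin d → ℝ) (m : Fin d → ℤ), f (x + fun i => (m i : ℝ)) = f x) :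
    ∃ g : C(UnitAddTorus (Fin d), ℂ),
      ∀ x : Fin d → ℝ, g (fun i => ((x i : ℝ) : UnitAddCircle)) = (f x : ℂ) := by
  have hq : IsOpenQuotientMap (Pi.map fun (_ : Fin d) (x : ℝ) => (x : UnitAddCircle)) :=
    IsOpenQuotientMap.piMap fun _ => QuotientAddGroup.isOpenQuotientMap_mk
  let G : UnitAddTorus (Fin d) → ℂ := fun t => (f (fun i => Quotient.out (t i)) : ℂ)
  have hG : ∀ x : Fin d → ℝ, G (fun i => ((x i : ℝ) : UnitAddCircle)) = (f x : ℂ) := by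
    intro x
    have h : ∀ i, ∃ m : ℤ,
        (Quotient.out ((x i : ℝ) : UnitAddCircle) : ℝ) = x i + m := by
      intro i
      have h1 : ((Quotient.out ((x i : ℝ) : UnitAddCircle) : ℝ) : UnitAddCircle) = (x i : ℝ) :=
        Quotient.out_eq _
      have h2 := (QuotientAddGroup.eq_iff_sub_mem).1 h1
      obtain ⟨m, hm⟩ := AddSubgroup.mem_zmultiples_iff.1 h2
      refine ⟨m, ?_⟩
      simp only [zsmul_eq_mul, mul_one] at hm
      linarith
    choose m hm using h
    have h3 : (fun i => (Quotient.out ((x i : ℝ) : UnitAddCircle) : ℝ))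
      = x + fun i => (m i : ℝ) := funext hm
    show ((f (fun i => (Quotient.out ((x i : ℝ) : UnitAddCircle) : ℝ)) : ℝ) : ℂ) = _
    rw [h3, hper]
  refine ⟨⟨G, ?_⟩, hG⟩
  rw [hq.isQuotientMap.continuous_iff]
  have : G ∘ (Pi.map fun (_ : Fin d) (x : ℝ) => (x : UnitAddCircle)) = fun x => (f x : ℂ) :=
    funext hG
  rw [this]
  exact Complex.continuous_ofReal.comp hf

open MeasureTheory

/-- Weyl equidistribution: if `1, a₁, …, a_d` are linearly independent over `ℚ` and
`f : ℝ^d → ℝ` is continuous and `ℤ^d`-periodic, then the Cesàro averages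
`(1/M) ∑_{n=1}^M f(n a)` converge to `∫_{[0,1]^d} f`. -/
theorem weyl_equidistribution_continuous (d : ℕ) (hd : 1 ≤ d) (a : Fin d → ℝ)
    (hlin : ∀ (c : ℤ) (α : Fin d → ℤ),
      (c : ℝ) + ∑ i, (α i : ℝ) * a i = 0 → c = 0 ∧ ∀ i, α i = 0)
    (f : (Fin d → ℝ) → ℝ) (hf : Continuous f)
    (hper : ∀ (x : Fin d → ℝ) (m : Fin d → ℤ), f (x + fun i => (m i : ℝ)) = f x) :
    Filter.Tendsto
      (fun M : ℕ => (1 / (M : ℝ)) * ∑ n ∈ Finset.Icc 1 M, f (fun i => (n : ℝ) * a i))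
      Filter.atTop (nhds (∫ x in Set.Icc (0 : Fin d → ℝ) 1, f x)) := by

  obtain ⟨g, hg⟩ := wlift d f hf hper
  have h := wall d a hlin g
  have e : ∀ n : ℕ, g (fun i => (((n : ℝ) * a i : ℝ) : UnitAddCircle)) =
    (f (fun i => (n : ℝ) * a i) : ℂ) := fun n => hg _
  simp only [e, hg] at h
  rw [integral_complex_ofReal] at h
  have h' := (Complex.continuous_re.tendsto _).comp h
  rw [Complex.ofReal_re] at h'
  refine h'.congr fun M => ?_
  have : (1 / (M : ℂ)) * ∑ n ∈ Finset.Icc 1 M, (f (fun i => (n : ℝ) * a i) : ℂ) =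
    (((1 / (M : ℝ)) * ∑ n ∈ Finset.Icc 1 M, f (fun i => (n : ℝ) * a i) : ℝ) : ℂ) := by
    push_cast; rfl
  rw [Function.comp_apply, this, Complex.ofReal_re]
end

section
/- Let d ≥ 1 and let a₁,…,a_d be real numbers such that 1, a₁,…,a_d are linearly independent over ℚ. Regard the torus T = (ℝ/ℤ)^d with its quotient metric (the product of the AddCircle metrics) and its Haar (uniform probability) measure μ. For y ∈ T and r > 0 let B(y,r) = { x ∈ T : dist(x,y) ≤ r } be the closed ball. Then lim_{M → ∞} (1/M) Σ_{n=1}^{M} 1_{B(y,r)}( π(n a₁, …, n a_d) ) = μ(B(y,r)), where π : ℝ^d → T is the quotient map and 1_{B(y,r)} is the indicator function of B(y,r). -/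
open MeasureTheory

namespace TorusEqui

open Filter Topology

abbrev pt {d : ℕ} (a : Fin d → ℝ) (n : ℕ) : Fin d → AddCircle (1 : ℝ) :=
  fun i => (((n : ℝ) * a i : ℝ) : AddCircle (1 : ℝ))

noncomputable abbrev ch {d : ℕ} (k : Fin d → ℤ) : C(Fin d → AddCircle (1 : ℝ), ℂ) :=
  UnitAddTorus.mFourier k

lemma ch_add {d : ℕ} (k : Fin d → ℤ) (x y : Fin d → AddCircle (1 : ℝ)) :
    ch k (x + y) = ch k x * ch k y := by
  simp only [ch, UnitAddTorus.mFourier, ContinuousMap.coe_mk, ← Finset.prod_mul_distrib]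
  refine Finset.prod_congr rfl fun i _ => ?_
  rw [fourier_apply, fourier_apply, fourier_apply, Pi.add_apply, zsmul_add, AddCircle.toCircle_add,
    Circle.coe_mul]

lemma ch_pt_eq {d : ℕ} (k : Fin d → ℤ) (a : Fin d → ℝ) (n : ℕ) :
    ch k (pt a n) = Complex.exp (2 * Real.pi * Complex.I * (∑ i, (k i : ℝ) * a i : ℝ)) ^ n := by
  simp only [ch, UnitAddTorus.mFourier, ContinuousMap.coe_mk, fourier_coe_apply]
  rw [← Complex.exp_sum, ← Complex.exp_nat_mul]
  congr 1
  push_cast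
  rw [Finset.mul_sum, Finset.mul_sum]
  refine Finset.sum_congr rfl fun i _ => ?_
  ring

lemma ch_norm {d : ℕ} (k : Fin d → ℤ) (x : Fin d → AddCircle (1 : ℝ)) : ‖ch k x‖ = 1 := by
  simp only [ch, UnitAddTorus.mFourier, ContinuousMap.coe_mk, norm_prod, fourier_apply]
  exact Finset.prod_eq_one fun i _ => Circle.norm_coe _

lemma exp_ne_one {d : ℕ} (a : Fin d → ℝ)
    (hlin : ∀ (c : ℤ) (α : Fin d → ℤ),
      (c : ℝ) + ∑ i, (α i : ℝ) * a i = 0 → c = 0 ∧ ∀ i, α i = 0)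
    (k : Fin d → ℤ) (hk : k ≠ 0) :
    Complex.exp (2 * Real.pi * Complex.I * (∑ i, (k i : ℝ) * a i : ℝ)) ≠ 1 := by
  intro h
  rw [Complex.exp_eq_one_iff] at h
  obtain ⟨n, hn⟩ := h
  have h2 : (2 * Real.pi * Complex.I : ℂ) ≠ 0 := Complex.two_pi_I_ne_zero
  rw [mul_comm (n : ℂ)] at hn
  have h3 := mul_left_cancel₀ h2 hn
  have h4 : (∑ i, (k i : ℝ) * a i : ℝ) = n := by exact_mod_cast h3
  have h5 := hlin (-n) k (by rw [h4]; push_cast; ring)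
  exact hk (funext h5.2)

lemma integral_ch {d : ℕ} (a : Fin d → ℝ)
    (hlin : ∀ (c : ℤ) (α : Fin d → ℤ),
      (c : ℝ) + ∑ i, (α i : ℝ) * a i = 0 → c = 0 ∧ ∀ i, α i = 0)
    (k : Fin d → ℤ) (hk : k ≠ 0) :
    ∫ x, ch k x = 0 := by
  have h := integral_add_right_eq_self (μ := (volume : Measure (Fin d → AddCircle (1 : ℝ))))
    (fun x => ch k x) (pt a 1)
  simp only [ch_add] at h
  rw [integral_mul_const, ch_pt_eq, pow_one] at h
  have h1 := exp_ne_one a hlin k hk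
  by_contra h0
  exact h1 (mul_left_cancel₀ h0 (by rw [h, mul_one]))

noncomputable def avg {d : ℕ} (a : Fin d → ℝ) (M : ℕ) (g : (Fin d → AddCircle (1 : ℝ)) → ℂ) : ℂ :=
  ((M + 1 : ℕ) : ℂ)⁻¹ * ∑ n ∈ Finset.range (M + 1), g (pt a (n + 1))

instance : IsProbabilityMeasure (volume : Measure (AddCircle (1 : ℝ))) := ⟨by simp⟩

lemma tendsto_avg_ch {d : ℕ} (a : Fin d → ℝ)
    (hlin : ∀ (c : ℤ) (α : Fin d → ℤ),
      (c : ℝ) + ∑ i, (α i : ℝ) * a i = 0 → c = 0 ∧ ∀ i, α i = 0)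
    (k : Fin d → ℤ) :
    Tendsto (fun M => avg a M (ch k)) atTop (𝓝 (∫ x, ch k x)) := by
  by_cases hk : k = 0
  · subst hk
    have : ∀ x, ch (0 : Fin d → ℤ) x = 1 := fun x => by
      rw [ch, UnitAddTorus.mFourier_zero]; rfl
    simp only [this, avg]
    simp only [Finset.sum_const, Finset.card_range, nsmul_eq_mul, mul_one, integral_const,
      probReal_univ, one_smul]
    refine tendsto_const_nhds.congr fun M => ?_
    rw [inv_mul_cancel₀]
    exact_mod_cast Nat.succ_ne_zero M
  · rw [integral_ch a hlin k hk]
    set z := Complex.exp (2 * Real.pi * Complex.I * (∑ i, (k i : ℝ) * a i : ℝ)) with hz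
    have hz1 : z ≠ 1 := exp_ne_one a hlin k hk
    have hzn : ‖z‖ = 1 := by
      have := ch_norm k (pt a 1)
      rwa [ch_pt_eq, pow_one] at this
    have hpos : 0 < ‖z - 1‖ := norm_pos_iff.2 (sub_ne_zero.2 hz1)
    have key : ∀ M : ℕ, ‖avg a M (ch k)‖ ≤ ((M : ℝ) + 1)⁻¹ * (2 / ‖z - 1‖) := by
      intro M
      rw [avg, norm_mul, norm_inv, Complex.norm_natCast]
      push_cast
      gcongr
      simp only [ch_pt_eq, ← hz, pow_succ, ← Finset.sum_mul]
      rw [geom_sum_eq hz1, norm_mul, hzn, mul_one, norm_div]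
      gcongr
      refine (norm_sub_le _ _).trans ?_
      rw [norm_pow, hzn]; norm_num
    refine squeeze_zero_norm key ?_
    have h := (tendsto_one_div_add_atTop_nhds_zero_nat (𝕜 := ℝ)).mul_const (2 / ‖z - 1‖)
    simpa using h

lemma avg_sub_le {d : ℕ} (a : Fin d → ℝ) (M : ℕ) (f g : C(Fin d → AddCircle (1 : ℝ), ℂ)) :
    ‖avg a M f - avg a M g‖ ≤ ‖f - g‖ := by
  rw [avg, avg, ← mul_sub, ← Finset.sum_sub_distrib, norm_mul, norm_inv, Complex.norm_natCast]
  have h : ‖∑ n ∈ Finset.range (M + 1), (f (pt a (n + 1)) - g (pt a (n + 1)))‖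
      ≤ ((M + 1 : ℕ) : ℝ) * ‖f - g‖ := by
    refine (norm_sum_le_of_le _ fun n _ => ContinuousMap.norm_coe_le_norm (f - g) _).trans ?_
    simp
  have hp : (0 : ℝ) < ((M + 1 : ℕ) : ℝ) := by positivity
  rw [inv_mul_le_iff₀ hp]
  exact h

lemma integrable_cm {d : ℕ} (f : C(Fin d → AddCircle (1 : ℝ), ℂ)) : Integrable (fun x => f x) :=
  f.continuous.integrable_of_hasCompactSupport (HasCompactSupport.of_compactSpace _)

lemma int_sub_le {d : ℕ} (f g : C(Fin d → AddCircle (1 : ℝ), ℂ)) :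
    ‖(∫ x, f x) - ∫ x, g x‖ ≤ ‖f - g‖ := by
  rw [← integral_sub (integrable_cm f) (integrable_cm g)]
  have := norm_integral_le_of_norm_le_const
    (μ := (volume : Measure (Fin d → AddCircle (1 : ℝ)))) (f := fun x => f x - g x)
    (C := ‖f - g‖) (Eventually.of_forall fun x => ContinuousMap.norm_coe_le_norm (f - g) x)
  simpa using this

lemma tendsto_avg {d : ℕ} (a : Fin d → ℝ)
    (hlin : ∀ (c : ℤ) (α : Fin d → ℤ),
      (c : ℝ) + ∑ i, (α i : ℝ) * a i = 0 → c = 0 ∧ ∀ i, α i = 0)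
    (f : C(Fin d → AddCircle (1 : ℝ), ℂ)) :
    Tendsto (fun M => avg a M f) atTop (𝓝 (∫ x, f x)) := by
  have hspan : ∀ g ∈ Submodule.span ℂ (Set.range (UnitAddTorus.mFourier (d := Fin d))),
      Tendsto (fun M => avg a M g) atTop (𝓝 (∫ x, g x)) := by
    intro g hg
    induction hg using Submodule.span_induction with
    | mem g hg =>
      obtain ⟨k, rfl⟩ := hg
      exact tendsto_avg_ch a hlin k
    | zero => simp [avg]
    | add g h _ _ hg hh =>
      have := hg.add hh
      rw [← integral_add (integrable_cm g) (integrable_cm h)] at this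
      refine this.congr fun M => ?_
      simp [avg, Finset.sum_add_distrib, mul_add]
    | smul c g _ hg =>
      have := hg.const_mul c
      rw [← integral_const_mul] at this
      refine this.congr fun M => ?_
      simp only [avg, ContinuousMap.coe_smul, Pi.smul_apply, smul_eq_mul, ← Finset.mul_sum]
      ring
  have hf : f ∈ closure
      (Submodule.span ℂ (Set.range (UnitAddTorus.mFourier (d := Fin d))) : Set _) := by
    rw [← Submodule.topologicalClosure_coe, UnitAddTorus.span_mFourier_closure_eq_top]
    trivial
  rw [Metric.tendsto_atTop]
  intro ε hε
  obtain ⟨g, hg, hfg⟩ := Metric.mem_closure_iff.1 hf (ε / 3) (by positivity)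
  obtain ⟨N, hN⟩ := Metric.tendsto_atTop.1 (hspan g hg) (ε / 3) (by positivity)
  refine ⟨N, fun M hM => ?_⟩
  have h1 := avg_sub_le a M f g
  have h2 := int_sub_le f g
  have h3 := hN M hM
  rw [dist_eq_norm] at hfg
  rw [← dist_eq_norm] at h1 h2
  rw [dist_comm] at h2
  have h4 := dist_triangle4 (avg a M f) (avg a M g) (∫ x, g x) (∫ x, f x)
  linarith

noncomputable def emp {d : ℕ} (a : Fin d → ℝ) (M : ℕ) : Measure (Fin d → AddCircle (1 : ℝ)) :=
  ((M + 1 : ℕ) : ENNReal)⁻¹ • ∑ n ∈ Finset.range (M + 1), Measure.dirac (pt a (n + 1))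

instance {d : ℕ} (a : Fin d → ℝ) (M : ℕ) : IsProbabilityMeasure (emp a M) := ⟨by
  rw [emp, Measure.smul_apply, Measure.finsetSum_apply]
  simp only [measure_univ, Finset.sum_const, Finset.card_range, nsmul_eq_mul, mul_one, smul_eq_mul]
  exact ENNReal.inv_mul_cancel (by simp) (by simp)⟩

lemma integral_emp {d : ℕ} (a : Fin d → ℝ) (M : ℕ) (f : C(Fin d → AddCircle (1 : ℝ), ℂ)) :
    ∫ x, f x ∂(emp a M) = avg a M f := by
  rw [emp, integral_smul_measure, integral_finsetSum_measure]
  · simp only [avg, integral_dirac, ENNReal.toReal_inv, ENNReal.toReal_natCast]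
    rw [Complex.real_smul]
    push_cast
    rfl
  · intro i _
    exact f.continuous.integrable_of_hasCompactSupport (HasCompactSupport.of_compactSpace _)

lemma null_frontier {d : ℕ} (y : Fin d → AddCircle (1 : ℝ)) (r : ℝ) (hr : 0 < r) :
    volume (frontier (Metric.closedBall y r)) = 0 := by
  have hs : ∀ z : AddCircle (1 : ℝ), volume (Metric.sphere z r) = 0 := by
    intro z
    rw [← Metric.closedBall_sdiff_ball]
    exact ae_le_set.1 (AddCircle.closedBall_ae_eq_ball (x := z) (ε := r)).le
  have hsub : frontier (Metric.closedBall y r) ⊆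
      ⋃ i, (Function.eval i) ⁻¹' (Metric.sphere (y i) r) := by
    intro x hx
    have h := Metric.frontier_closedBall_subset_sphere hx
    rw [Metric.mem_sphere] at h
    by_contra hc
    simp only [Set.mem_iUnion, Set.mem_preimage, Metric.mem_sphere, not_exists,
      Function.eval] at hc
    have : dist x y < r := (dist_pi_lt_iff hr).2 fun i =>
      lt_of_le_of_ne (h ▸ dist_le_pi_dist x y i) (hc i)
    exact this.ne h
  refine measure_mono_null hsub (measure_iUnion_null fun i => ?_)
  exact Measure.pi_eval_preimage_null _ (hs _)

noncomputable def empP {d : ℕ} (a : Fin d → ℝ) (M : ℕ) :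
    ProbabilityMeasure (Fin d → AddCircle (1 : ℝ)) := ⟨emp a M, inferInstance⟩

noncomputable def volP (d : ℕ) :
    ProbabilityMeasure (Fin d → AddCircle (1 : ℝ)) := ⟨volume, inferInstance⟩

end TorusEqui

/-- Equidistribution for indicator functions of closed balls on the torus `(ℝ/ℤ)^d`:
if `1, a₁, …, a_d` are linearly independent over `ℚ`, then for any `y` in the torus and
`r > 0`, the Cesàro averages of the indicator of the closed ball `B(y,r)` along the orbit
`n ↦ π(n a)` converge to the Haar measure of `B(y,r)`. -/
theorem torus_ball_equidistribution (d : ℕ) (hd : 1 ≤ d) (a : Fin d → ℝ)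
    (hlin : ∀ (c : ℤ) (α : Fin d → ℤ),
      (c : ℝ) + ∑ i, (α i : ℝ) * a i = 0 → c = 0 ∧ ∀ i, α i = 0)
    (y : Fin d → AddCircle (1 : ℝ)) (r : ℝ) (hr : 0 < r) :
    Filter.Tendsto
      (fun M : ℕ => (1 / (M : ℝ)) *
        ∑ n ∈ Finset.Icc 1 M,
          Set.indicator (Metric.closedBall y r) (fun _ => (1 : ℝ))
            (fun i => (((n : ℝ) * a i : ℝ) : AddCircle (1 : ℝ))))
      Filter.atTop (nhds ((volume (Metric.closedBall y r)).toReal)) := by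
  have hlim : Filter.Tendsto (fun M => TorusEqui.empP a M) Filter.atTop
      (nhds (TorusEqui.volP d)) := by
    rw [ProbabilityMeasure.tendsto_iff_forall_integral_rclike_tendsto ℂ]
    intro f
    have h := TorusEqui.tendsto_avg a hlin f.toContinuousMap
    refine h.congr fun M => ?_
    exact (TorusEqui.integral_emp a M f.toContinuousMap).symm
  have h := ProbabilityMeasure.tendsto_measure_of_null_frontier_of_tendsto' hlim
    (E := Metric.closedBall y r) (TorusEqui.null_frontier y r hr)
  have h2 := (ENNReal.tendsto_toReal (measure_ne_top _ _)).comp h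
  rw [← Filter.tendsto_add_atTop_iff_nat 1]
  refine h2.congr fun M => ?_
  simp only [Function.comp, TorusEqui.empP, ProbabilityMeasure.coe_mk, TorusEqui.emp, Measure.smul_apply,
    Measure.finsetSum_apply, smul_eq_mul, ENNReal.toReal_mul, ENNReal.toReal_inv,
    ENNReal.toReal_natCast, one_div]
  congr 1
  rw [ENNReal.toReal_sum (fun _ _ => measure_ne_top _ _), Finset.range_eq_Ico, Finset.sum_Ico_add'
    (fun n => (Measure.dirac (TorusEqui.pt a n) (Metric.closedBall y r)).toReal) 0 (M + 1) 1]
  refine Finset.sum_congr (by ext; simp only [Finset.mem_Ico, Finset.mem_Icc]; omega) fun n _ => ?_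
  rw [Measure.dirac_apply' _ Metric.isClosed_closedBall.measurableSet]
  by_cases hn : TorusEqui.pt a n ∈ Metric.closedBall y r
  · rw [Set.indicator_of_mem hn, Set.indicator_of_mem hn]; simp
  · rw [Set.indicator_of_notMem hn, Set.indicator_of_notMem hn]; simp
end

section
/- Let d ≥ 1, n ≥ 1, let g : [0,1]^d → ℝ be continuous with modulus of continuity ω (with respect to the Euclidean norm), and let M be a real number with M ≥ ω(√d). Then for every x ∈ [0,1]^d and every δ > 0, |g(x) − B_n g(x)| ≤ ω(δ) + M·((1 + d/(4 n δ²))^d − 1). -/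
/-- The multivariate Bernstein polynomial of `g : [0,1]^d → ℝ`:
`B_n g(x) = ∑_{p ∈ {0,…,n}^d} g(p/n) ∏_i C(n,pᵢ) xᵢ^{pᵢ} (1-xᵢ)^{n-pᵢ}`. -/
noncomputable def bernsteinApprox (d n : ℕ) (g : (Fin d → ℝ) → ℝ) (x : Fin d → ℝ) : ℝ :=
  ∑ p : Fin d → Fin (n + 1), g (fun i => (p i : ℝ) / n) *
    ∏ i, (n.choose (p i) : ℝ) * x i ^ (p i : ℕ) * (1 - x i) ^ (n - (p i : ℕ))

/-- one-dimensional Bernstein weight -/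
noncomputable def bbW (n : ℕ) (x : ℝ) (k : Fin (n + 1)) : ℝ :=
  (n.choose k : ℝ) * x ^ (k : ℕ) * (1 - x) ^ (n - (k : ℕ))

lemma bbW_nonneg (n : ℕ) (x : ℝ) (h0 : 0 ≤ x) (h1 : x ≤ 1) (k : Fin (n + 1)) :
    0 ≤ bbW n x k := by
  have : 0 ≤ 1 - x := by linarith
  unfold bbW
  positivity

lemma bbW_sum (n : ℕ) (x : ℝ) (h0 : 0 ≤ x) (h1 : x ≤ 1) : ∑ k, bbW n x k = 1 := by
  have := bernstein.probability n ⟨x, h0, h1⟩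
  simpa [bernstein_apply, bbW] using this

lemma bbW_var (n : ℕ) (hn : 1 ≤ n) (x : ℝ) (h0 : 0 ≤ x) (h1 : x ≤ 1) :
    ∑ k : Fin (n + 1), (x - (k : ℝ) / n) ^ 2 * bbW n x k ≤ 1 / (4 * n) := by
  have := bernstein.variance (n := n) (by omega) ⟨x, h0, h1⟩
  simp only [bernstein_apply, bernstein.z] at this
  have h2 : ∑ k : Fin (n + 1), (x - (k : ℝ) / n) ^ 2 * bbW n x k = x * (1 - x) / n := by
    simpa [bbW] using this
  rw [h2]
  have hn' : (0 : ℝ) < n := by exact_mod_cast hn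
  rw [div_le_div_iff₀ hn' (by positivity)]
  nlinarith [mul_nonneg hn'.le (sq_nonneg (2 * x - 1))]

lemma bb_prod_sum (d n : ℕ) (x : Fin d → ℝ) (h0 : ∀ i, 0 ≤ x i) (h1 : ∀ i, x i ≤ 1) :
    ∑ p : Fin d → Fin (n + 1), ∏ i, bbW n (x i) (p i) = 1 := by
  rw [← Fintype.piFinset_univ, ← Finset.prod_univ_sum (fun _ => Finset.univ)
    (fun i k => bbW n (x i) k)]
  exact Finset.prod_eq_one fun i _ => bbW_sum n _ (h0 i) (h1 i)

lemma bb_prod_marg (d n : ℕ) (x : Fin d → ℝ) (h0 : ∀ i, 0 ≤ x i) (h1 : ∀ i, x i ≤ 1)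
    (i : Fin d) (h : Fin (n + 1) → ℝ) :
    ∑ p : Fin d → Fin (n + 1), h (p i) * ∏ j, bbW n (x j) (p j) =
      ∑ k, h k * bbW n (x i) k := by
  have key := Finset.prod_univ_sum (fun _ : Fin d => (Finset.univ : Finset (Fin (n + 1))))
    (fun j k => (if j = i then h k else 1) * bbW n (x j) k)
  simp only [Finset.prod_mul_distrib, Finset.prod_ite_eq', Finset.mem_univ, if_true,
    Fintype.piFinset_univ] at key
  rw [← key, Finset.prod_eq_single i]
  · simp
  · intro j _ hj
    simp [hj, bbW_sum n _ (h0 j) (h1 j)]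
  · simp

/-- Error bound for multivariate Bernstein approximation: if `ω` is the modulus of
continuity of `g` on `[0,1]^d` (w.r.t. the Euclidean norm) and `M ≥ ω(√d)`, then for all
`x ∈ [0,1]^d` and `δ > 0`,
`|g(x) − B_n g(x)| ≤ ω(δ) + M((1 + d/(4nδ²))^d − 1)`. -/
theorem bernstein_error_bound (d n : ℕ) (hd : 1 ≤ d) (hn : 1 ≤ n)
    (g : (Fin d → ℝ) → ℝ) (hg : ContinuousOn g (Set.Icc (0 : Fin d → ℝ) 1))
    (ω : ℝ → ℝ)
    (hω : ∀ δ : ℝ, ω δ = sSup {t : ℝ | ∃ x ∈ Set.Icc (0 : Fin d → ℝ) 1,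
      ∃ y ∈ Set.Icc (0 : Fin d → ℝ) 1,
        Real.sqrt (∑ i, (x i - y i) ^ 2) ≤ δ ∧ t = |g x - g y|})
    (M : ℝ) (hM : ω (Real.sqrt d) ≤ M) :
    ∀ x ∈ Set.Icc (0 : Fin d → ℝ) 1, ∀ δ : ℝ, 0 < δ →
      |g x - bernsteinApprox d n g x| ≤
        ω δ + M * ((1 + (d : ℝ) / (4 * n * δ ^ 2)) ^ d - 1) := by
  intro x hx δ hδ
  have h0 : ∀ i, 0 ≤ x i := fun i => hx.1 i
  have h1 : ∀ i, x i ≤ 1 := fun i => hx.2 i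
  have hn' : (0 : ℝ) < n := by exact_mod_cast hn
  obtain ⟨C, hC⟩ := isCompact_Icc.exists_bound_of_continuousOn hg
  have hle : ∀ ε : ℝ, ∀ y ∈ Set.Icc (0 : Fin d → ℝ) 1,
      Real.sqrt (∑ i, (x i - y i) ^ 2) ≤ ε → |g x - g y| ≤ ω ε := by
    intro ε y hy hxy
    rw [hω]
    refine le_csSup ⟨C + C, ?_⟩ ⟨x, hx, y, hy, hxy, rfl⟩
    rintro t ⟨a, ha, b, hb, -, rfl⟩
    have h2 := hC a ha
    have h3 := hC b hb
    rw [Real.norm_eq_abs] at h2 h3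
    exact (abs_sub _ _).trans (add_le_add h2 h3)
  have hω0 : 0 ≤ ω δ := (abs_nonneg _).trans (hle δ x hx (by simpa using hδ.le))
  have hM0 : 0 ≤ M :=
    ((abs_nonneg _).trans (hle (Real.sqrt d) x hx (by simp))).trans hM
  have hpt : ∀ y ∈ Set.Icc (0 : Fin d → ℝ) 1,
      |g x - g y| ≤ ω δ + M / δ ^ 2 * ∑ i, (x i - y i) ^ 2 := by
    intro y hy
    have hS : 0 ≤ ∑ i, (x i - y i) ^ 2 := Finset.sum_nonneg fun i _ => sq_nonneg _
    by_cases hc : Real.sqrt (∑ i, (x i - y i) ^ 2) ≤ δ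
    · have := hle δ y hy hc
      have : 0 ≤ M / δ ^ 2 * ∑ i, (x i - y i) ^ 2 := by positivity
      linarith
    · have hc' : δ ^ 2 < ∑ i, (x i - y i) ^ 2 := (Real.lt_sqrt hδ.le).1 (not_le.1 hc)
      have hb : |g x - g y| ≤ M := by
        refine (hle (Real.sqrt d) y hy (Real.sqrt_le_sqrt ?_)).trans hM
        calc ∑ i, (x i - y i) ^ 2 ≤ ∑ i : Fin d, (1 : ℝ) := by
              refine Finset.sum_le_sum fun i _ => ?_
              have a1 := h0 i
              have a2 := h1 i
              have a3 : 0 ≤ y i := hy.1 i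
              have a4 : y i ≤ 1 := hy.2 i
              rw [sq_le_one_iff_abs_le_one, abs_le]
              constructor <;> linarith
          _ = d := by simp
      have : M ≤ M / δ ^ 2 * ∑ i, (x i - y i) ^ 2 := by
        calc M = M / δ ^ 2 * δ ^ 2 := by field_simp
          _ ≤ _ := by gcongr
      linarith
  have hmain : |g x - bernsteinApprox d n g x| ≤ ω δ + M / δ ^ 2 * (d * (1 / (4 * n))) := by
    have e1 : g x - bernsteinApprox d n g x = ∑ p : Fin d → Fin (n + 1),
        (g x - g (fun i => (p i : ℝ) / n)) * ∏ i, bbW n (x i) (p i) := by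
      simp only [sub_mul, Finset.sum_sub_distrib, ← Finset.mul_sum]
      rw [bb_prod_sum d n x h0 h1, mul_one]
      rfl
    have hw : ∀ p : Fin d → Fin (n + 1), 0 ≤ ∏ i, bbW n (x i) (p i) := fun p =>
      Finset.prod_nonneg fun i _ => bbW_nonneg n _ (h0 i) (h1 i) _
    rw [e1]
    calc _ ≤ ∑ p : Fin d → Fin (n + 1),
        |(g x - g (fun i => (p i : ℝ) / n)) * ∏ i, bbW n (x i) (p i)| :=
          Finset.abs_sum_le_sum_abs _ _
      _ ≤ ∑ p : Fin d → Fin (n + 1), (ω δ + M / δ ^ 2 * ∑ i, (x i - (p i : ℝ) / n) ^ 2) *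
          ∏ i, bbW n (x i) (p i) := by
        refine Finset.sum_le_sum fun p _ => ?_
        rw [abs_mul, abs_of_nonneg (hw p)]
        refine mul_le_mul_of_nonneg_right (hpt _ ⟨fun i => ?_, fun i => ?_⟩) (hw p)
        · show (0 : ℝ) ≤ (p i : ℝ) / n
          positivity
        · show (p i : ℝ) / n ≤ 1
          rw [div_le_one hn']
          exact_mod_cast Nat.lt_succ_iff.1 (p i).2
      _ = ω δ + M / δ ^ 2 * ∑ i, ∑ k : Fin (n + 1),
            (x i - (k : ℝ) / n) ^ 2 * bbW n (x i) k := by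
        simp only [add_mul, Finset.sum_add_distrib, ← Finset.mul_sum, mul_assoc]
        rw [bb_prod_sum d n x h0 h1, mul_one]
        simp only [Finset.sum_mul]
        rw [Finset.sum_comm]
        congr 2
        refine Finset.sum_congr rfl fun i _ => ?_
        exact bb_prod_marg d n x h0 h1 i (fun k => (x i - (k : ℝ) / n) ^ 2)
      _ ≤ ω δ + M / δ ^ 2 * ∑ i : Fin d, (1 / (4 * n) : ℝ) := by
        gcongr with i _
        exact bbW_var n hn _ (h0 i) (h1 i)
      _ = _ := by simp
  refine hmain.trans ?_
  have e2 : M / δ ^ 2 * (d * (1 / (4 * n))) = M * ((d : ℝ) / (4 * n * δ ^ 2)) := by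
    field_simp
  rw [e2]
  have ha : 0 ≤ (d : ℝ) / (4 * n * δ ^ 2) := by positivity
  have hb : 1 + (d : ℝ) / (4 * n * δ ^ 2) ≤ (1 + (d : ℝ) / (4 * n * δ ^ 2)) ^ d :=
    le_self_pow₀ (by linarith) (by omega)
  gcongr
  linarith
end

section
/- Let d ≥ 1, let g : [0,1]^d → ℝ be continuous with modulus of continuity ω (with respect to the Euclidean norm), let M ≥ ω(√d), and let ε > 0 with ε < 2M. Suppose δ > 0 satisfies ω(δ) < ε and n is an integer with n > M d² / (2 (ε − ω(δ)) δ²). Then |g(x) − B_n g(x)| < ε for all x ∈ [0,1]^d. -/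
theorem bern_aux_sum (n : ℕ) (x : ℝ) : ∑ k : Fin (n+1), (n.choose k : ℝ) * x ^ (k:ℕ) * (1 - x) ^ (n - (k:ℕ)) = 1 := by
  rw [Fin.sum_univ_eq_sum_range (fun k => (n.choose k : ℝ) * x ^ k * (1 - x) ^ (n - k))]
  have := add_pow x (1-x) n
  rw [add_sub_cancel, one_pow] at this
  refine Eq.trans ?_ this.symm
  exact Finset.sum_congr rfl fun k _ => by ring

theorem bern_aux_var (n : ℕ) (hn : n ≠ 0) (x : ℝ) (h0 : 0 ≤ x) (h1 : x ≤ 1) :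
    ∑ k : Fin (n+1), (n.choose k : ℝ) * x ^ (k:ℕ) * (1 - x) ^ (n - (k:ℕ)) * (x - (k:ℝ)/n)^2 = x * (1-x)/n := by
  have := bernstein.variance hn ⟨x, h0, h1⟩
  simp only [bernstein_apply, bernstein.z] at this
  rw [← this]
  exact Finset.sum_congr rfl fun k _ => by ring

theorem bern_aux_mom (d n : ℕ) (hn : n ≠ 0) (x : Fin d → ℝ) (h0 : ∀ i, 0 ≤ x i) (h1 : ∀ i, x i ≤ 1) (j : Fin d) :
    ∑ p : Fin d → Fin (n + 1), (x j - (p j : ℝ)/n)^2 *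
    ∏ i, ((n.choose (p i) : ℝ) * x i ^ (p i : ℕ) * (1 - x i) ^ (n - (p i : ℕ))) = x j * (1 - x j)/n := by
  have key := Finset.prod_univ_sum (fun _ : Fin d => (Finset.univ : Finset (Fin (n+1))))
    (fun i k => (n.choose k : ℝ) * x i ^ (k:ℕ) * (1 - x i) ^ (n - (k:ℕ)) * (if i = j then (x i - (k:ℝ)/n)^2 else 1))
  rw [Fintype.piFinset_univ] at key
  calc _ = _ := ?_
    _ = _ := key.symm
    _ = _ := ?_
  · refine Finset.sum_congr rfl fun p _ => ?_
    symm
    rw [Finset.prod_mul_distrib, mul_comm]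
    congr 1
    simp
  · rw [Finset.prod_eq_single j]
    · simp only [if_true]
      exact bern_aux_var n hn _ (h0 j) (h1 j)
    · intro i _ hi
      simp only [if_neg hi, mul_one]
      exact bern_aux_sum n _
    · simp

theorem bern_aux_one (d n : ℕ) (x : Fin d → ℝ)  :
    ∑ p : Fin d → Fin (n + 1), 
    ∏ i, ((n.choose (p i) : ℝ) * x i ^ (p i : ℕ) * (1 - x i) ^ (n - (p i : ℕ))) = 1 := by
  have key := Finset.prod_univ_sum (fun _ : Fin d => (Finset.univ : Finset (Fin (n+1))))
    (fun i k => (n.choose k : ℝ) * x i ^ (k:ℕ) * (1 - x i) ^ (n - (k:ℕ)))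
  rw [Fintype.piFinset_univ] at key
  rw [← key]
  exact Finset.prod_eq_one fun i _ => bern_aux_sum n _

/-- If `ω` is the modulus of continuity of `g` on `[0,1]^d` (w.r.t. the Euclidean norm),
`M ≥ ω(√d)`, `0 < ε < 2M`, `δ > 0` satisfies `ω(δ) < ε`, and
`n > M d² / (2(ε − ω(δ))δ²)`, then `|g(x) − B_n g(x)| < ε` on `[0,1]^d`. -/
theorem bernstein_eps_approximation (d : ℕ) (hd : 1 ≤ d)
    (g : (Fin d → ℝ) → ℝ) (hg : ContinuousOn g (Set.Icc (0 : Fin d → ℝ) 1))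
    (ω : ℝ → ℝ)
    (hω : ∀ δ : ℝ, ω δ = sSup {t : ℝ | ∃ x ∈ Set.Icc (0 : Fin d → ℝ) 1,
      ∃ y ∈ Set.Icc (0 : Fin d → ℝ) 1,
        Real.sqrt (∑ i, (x i - y i) ^ 2) ≤ δ ∧ t = |g x - g y|})
    (M : ℝ) (hM : ω (Real.sqrt d) ≤ M)
    (ε : ℝ) (hε : 0 < ε) (hε2 : ε < 2 * M)
    (δ : ℝ) (hδ : 0 < δ) (hωδ : ω δ < ε)
    (n : ℕ) (hn : M * (d : ℝ) ^ 2 / (2 * (ε - ω δ) * δ ^ 2) < (n : ℝ)) :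
    ∀ x ∈ Set.Icc (0 : Fin d → ℝ) 1, |g x - bernsteinApprox d n g x| < ε := by
  intro x hx
  have hMpos : 0 < M := by linarith
  have hgap : 0 < ε - ω δ := by linarith
  have hd' : (1:ℝ) ≤ d := by exact_mod_cast hd
  have hden : 0 < 2 * (ε - ω δ) * δ ^ 2 := by positivity
  have hnpos : (0:ℝ) < n := lt_of_le_of_lt (by positivity) hn
  have hn0 : n ≠ 0 := by rintro rfl; simp at hnpos
  have h0 : ∀ i, 0 ≤ x i := fun i => hx.1 i
  have h1 : ∀ i, x i ≤ 1 := fun i => hx.2 i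
  obtain ⟨C, hC⟩ := (isCompact_Icc (a := (0 : Fin d → ℝ)) (b := 1)).exists_bound_of_continuousOn hg
  have hle : ∀ r : ℝ, ∀ u ∈ Set.Icc (0 : Fin d → ℝ) 1, ∀ v ∈ Set.Icc (0 : Fin d → ℝ) 1,
      Real.sqrt (∑ i, (u i - v i) ^ 2) ≤ r → |g u - g v| ≤ ω r := by
    intro r u hu v hv huv
    rw [hω r]
    refine le_csSup ⟨C + C, ?_⟩ ⟨u, hu, v, hv, huv, rfl⟩
    rintro t ⟨a, ha, b, hb, -, rfl⟩
    have := hC a ha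
    have := hC b hb
    simp only [Real.norm_eq_abs] at *
    exact (abs_sub _ _).trans (by linarith)
  have hω0 : 0 ≤ ω δ := by
    have := hle δ x hx x hx (by simp [hδ.le])
    simpa using this
  have hpt : ∀ v ∈ Set.Icc (0 : Fin d → ℝ) 1,
      |g x - g v| ≤ ω δ + M / δ^2 * ∑ i, (x i - v i) ^ 2 := by
    intro v hv
    have hS : 0 ≤ ∑ i, (x i - v i) ^ 2 := Finset.sum_nonneg fun i _ => sq_nonneg _
    by_cases h : Real.sqrt (∑ i, (x i - v i) ^ 2) ≤ δ
    · have := hle δ x hx v hv h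
      have : 0 ≤ M / δ^2 * ∑ i, (x i - v i) ^ 2 := by positivity
      linarith
    · push Not at h
      have h2 : δ^2 < ∑ i, (x i - v i) ^ 2 := (Real.lt_sqrt hδ.le).1 h
      have h3 : |g x - g v| ≤ M := by
        refine (hle _ x hx v hv (Real.sqrt_le_sqrt ?_)).trans hM
        calc ∑ i, (x i - v i) ^ 2 ≤ ∑ i : Fin d, (1:ℝ) := by
              refine Finset.sum_le_sum fun i _ => ?_
              have a1 := h0 i
              have a2 := h1 i
              have a3 : 0 ≤ v i := hv.1 i
              have a4 : v i ≤ 1 := hv.2 i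
              rw [sq_le_one_iff_abs_le_one, abs_le]
              constructor <;> linarith
          _ = d := by simp
      have h4 : M ≤ M / δ^2 * ∑ i, (x i - v i) ^ 2 := by
        rw [div_mul_eq_mul_div, le_div_iff₀ (by positivity)]
        exact mul_le_mul_of_nonneg_left h2.le hMpos.le
      linarith
  set w : (Fin d → Fin (n+1)) → ℝ := fun p =>
    ∏ i, ((n.choose (p i) : ℝ) * x i ^ (p i : ℕ) * (1 - x i) ^ (n - (p i : ℕ))) with hw
  have hw0 : ∀ p, 0 ≤ w p := fun p => Finset.prod_nonneg fun i _ => by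
    have := h0 i
    have : 0 ≤ 1 - x i := by linarith [h1 i]
    positivity
  have hw1 : ∑ p, w p = 1 := bern_aux_one d n x
  have hmem : ∀ p : Fin d → Fin (n+1), (fun i => (p i : ℝ) / n) ∈ Set.Icc (0 : Fin d → ℝ) 1 := by
    intro p
    refine ⟨fun i => ?_, fun i => ?_⟩
    · show (0:ℝ) ≤ (p i : ℝ) / n
      positivity
    · show (p i : ℝ) / n ≤ 1
      rw [div_le_one hnpos]
      exact_mod_cast Nat.lt_succ_iff.1 (p i).2
  have hmom : ∑ p : Fin d → Fin (n+1), (∑ i, (x i - (p i : ℝ)/n)^2) * w p ≤ d / (4 * n) := by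
    simp_rw [Finset.sum_mul]
    rw [Finset.sum_comm]
    calc _ = ∑ j, x j * (1 - x j)/n :=
          Finset.sum_congr rfl fun j _ => bern_aux_mom d n hn0 x h0 h1 j
      _ ≤ ∑ j : Fin d, 1 / (4 * (n:ℝ)) := by
          refine Finset.sum_le_sum fun j _ => ?_
          rw [div_le_div_iff₀ hnpos (by positivity)]
          nlinarith [sq_nonneg (2 * x j - 1)]
      _ = _ := by simp [div_eq_mul_inv]
  have hmain : |g x - bernsteinApprox d n g x| ≤ ω δ + M / δ^2 * (d / (4 * n)) := by
    have e : g x - bernsteinApprox d n g x = ∑ p, (g x - g (fun i => (p i : ℝ) / n)) * w p := by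
      simp_rw [sub_mul]
      rw [Finset.sum_sub_distrib, ← Finset.mul_sum, hw1, mul_one]
      rfl
    rw [e]
    calc _ ≤ ∑ p, |(g x - g (fun i => (p i : ℝ) / n)) * w p| := Finset.abs_sum_le_sum_abs _ _
      _ ≤ ∑ p, (ω δ * w p + M / δ^2 * ((∑ i, (x i - (p i : ℝ)/n)^2) * w p)) := by
          refine Finset.sum_le_sum fun p _ => ?_
          rw [abs_mul, abs_of_nonneg (hw0 p), ← mul_assoc, ← add_mul]
          exact mul_le_mul_of_nonneg_right (hpt _ (hmem p)) (hw0 p)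
      _ = ω δ + M / δ^2 * ∑ p : Fin d → Fin (n+1), (∑ i, (x i - (p i : ℝ)/n)^2) * w p := by
          rw [Finset.sum_add_distrib, ← Finset.mul_sum, ← Finset.mul_sum, hw1, mul_one]
      _ ≤ _ := by
          have : 0 ≤ M / δ^2 := by positivity
          gcongr
  refine hmain.trans_lt ?_
  rw [div_lt_iff₀ hden] at hn
  have : M / δ^2 * (d / (4 * n)) < ε - ω δ := by
    rw [div_mul_div_comm, div_lt_iff₀ (by positivity)]
    have : M * d ≤ M * (d:ℝ)^2 := by
      apply mul_le_mul_of_nonneg_left _ hMpos.le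
      nlinarith
    have : 0 < n * (2 * (ε - ω δ) * δ ^ 2) := by positivity
    nlinarith
  linarith
end

section
/- Let d ≥ 1, let C > 0, and let g : [0,1]^d → ℝ be Lipschitz with constant C with respect to the Euclidean norm, i.e. |g(x) − g(y)| ≤ C ‖x − y‖₂ for all x, y ∈ [0,1]^d. Let ε > 0 with ε < 2C√d. Then for every integer n with n > 27 C³ d^{5/2} / (8 ε³), one has |g(x) − B_n g(x)| < ε for all x ∈ [0,1]^d. In particular, N = d·n = O(d^{7/2} ε^{-3}) qubits suffice to realize an ε-approximator, i.e. the approximation error satisfies ε = O(d^{7/6} N^{-1/3}). -/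
theorem aux_prob (n : ℕ) (t : ℝ) :
    ∑ k : Fin (n + 1), (n.choose k : ℝ) * t ^ (k : ℕ) * (1 - t) ^ (n - (k : ℕ)) = 1 := by
  rw [Fin.sum_univ_eq_sum_range (fun k => (n.choose k : ℝ) * t ^ k * (1 - t) ^ (n - k))]
  have h := add_pow t (1 - t) n
  rw [add_sub_cancel, one_pow] at h
  refine Eq.trans ?_ h.symm
  exact Finset.sum_congr rfl fun k _ => by ring

theorem aux_var (n : ℕ) (hn : n ≠ 0) (t : ℝ) (ht : t ∈ Set.Icc (0 : ℝ) 1) :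
    ∑ k : Fin (n + 1), (n.choose k : ℝ) * t ^ (k : ℕ) * (1 - t) ^ (n - (k : ℕ)) *
      (t - (k : ℝ) / n) ^ 2 = t * (1 - t) / n := by
  have h := bernstein.variance hn ⟨t, ht⟩
  simp only [bernstein_apply, bernstein.z] at h
  rw [← h]
  exact Finset.sum_congr rfl fun k _ => by ring

theorem aux_var_multi (d n : ℕ) (hn : n ≠ 0) (x : Fin d → ℝ) (hx : ∀ i, x i ∈ Set.Icc (0 : ℝ) 1)
    (i : Fin d) :
    ∑ p : Fin d → Fin (n + 1), (x i - (p i : ℝ) / n) ^ 2 *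
      ∏ j, (n.choose (p j) : ℝ) * x j ^ (p j : ℕ) * (1 - x j) ^ (n - (p j : ℕ))
      = x i * (1 - x i) / n := by
  have h := Finset.prod_univ_sum (fun _ : Fin d => (Finset.univ : Finset (Fin (n + 1))))
    (fun j k => (n.choose k : ℝ) * x j ^ (k : ℕ) * (1 - x j) ^ (n - (k : ℕ)) *
      (if j = i then (x j - (k : ℝ) / n) ^ 2 else 1))
  rw [Fintype.piFinset_univ] at h
  have h2 : ∀ p : Fin d → Fin (n + 1), (x i - (p i : ℝ) / n) ^ 2 *
      ∏ j, (n.choose (p j) : ℝ) * x j ^ (p j : ℕ) * (1 - x j) ^ (n - (p j : ℕ)) =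
      ∏ j, ((n.choose (p j) : ℝ) * x j ^ (p j : ℕ) * (1 - x j) ^ (n - (p j : ℕ)) *
      (if j = i then (x j - (p j : ℝ) / n) ^ 2 else 1)) := by
    intro p
    rw [Finset.prod_mul_distrib (f := fun j => (n.choose (p j) : ℝ) * x j ^ (p j : ℕ) *
      (1 - x j) ^ (n - (p j : ℕ))), Finset.prod_ite_eq' Finset.univ i
        (fun j => (x j - (p j : ℝ) / n) ^ 2)]
    simp only [Finset.mem_univ, if_true]
    ring
  rw [Finset.sum_congr rfl fun p _ => h2 p, ← h, Finset.prod_eq_single i]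
  · simp only [if_true]
    exact aux_var n hn (x i) (hx i)
  · intro j _ hj
    simp only [hj, if_false, mul_one]
    exact aux_prob n (x j)
  · simp

theorem aux_prob_multi (d n : ℕ) (x : Fin d → ℝ) :
    ∑ p : Fin d → Fin (n + 1),
      ∏ j, (n.choose (p j) : ℝ) * x j ^ (p j : ℕ) * (1 - x j) ^ (n - (p j : ℕ)) = 1 := by
  have h := Finset.prod_univ_sum (fun _ : Fin d => (Finset.univ : Finset (Fin (n + 1))))
    (fun j k => (n.choose k : ℝ) * x j ^ (k : ℕ) * (1 - x j) ^ (n - (k : ℕ)))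
  rw [Fintype.piFinset_univ] at h
  rw [← h]
  exact Finset.prod_eq_one fun j _ => aux_prob n (x j)

/-- If `g : [0,1]^d → ℝ` is Lipschitz with constant `C` for the Euclidean norm and
`0 < ε < 2C√d`, then every `n > 27 C³ d^{5/2} / (8 ε³)` gives `|g(x) − B_n g(x)| < ε`
on `[0,1]^d` (so `N = dn = O(d^{7/2} ε^{-3})` qubits suffice). -/
theorem bernstein_lipschitz_rate (d : ℕ) (hd : 1 ≤ d) (C : ℝ) (hC : 0 < C)
    (g : (Fin d → ℝ) → ℝ)
    (hLip : ∀ x ∈ Set.Icc (0 : Fin d → ℝ) 1, ∀ y ∈ Set.Icc (0 : Fin d → ℝ) 1,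
      |g x - g y| ≤ C * Real.sqrt (∑ i, (x i - y i) ^ 2))
    (ε : ℝ) (hε : 0 < ε) (hε2 : ε < 2 * C * Real.sqrt d)
    (n : ℕ) (hn : 27 * C ^ 3 * (d : ℝ) ^ ((5 : ℝ) / 2) / (8 * ε ^ 3) < (n : ℝ)) :
    ∀ x ∈ Set.Icc (0 : Fin d → ℝ) 1, |g x - bernsteinApprox d n g x| < ε := by
  intro x hx
  have hxi : ∀ i, x i ∈ Set.Icc (0 : ℝ) 1 := fun i => ⟨hx.1 i, hx.2 i⟩
  have hdR : (1 : ℝ) ≤ d := by exact_mod_cast hd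
  have hd0 : (0 : ℝ) ≤ d := by linarith
  -- the numerical estimate
  have hrpow : (d : ℝ) ^ ((5 : ℝ) / 2) = (d : ℝ) ^ 2 * Real.sqrt d := by
    rw [Real.sqrt_eq_rpow, ← Real.rpow_natCast, ← Real.rpow_add (by linarith)]
    norm_num
  have hs : Real.sqrt d ^ 2 = d := Real.sq_sqrt hd0
  have hs0 : 0 < Real.sqrt d := Real.sqrt_pos.mpr (by linarith)
  rw [hrpow, div_lt_iff₀ (by positivity)] at hn
  have hnpos : (0 : ℝ) < n := by
    by_contra hc
    have h1 : (n : ℝ) * (8 * ε ^ 3) ≤ 0 :=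
      mul_nonpos_of_nonpos_of_nonneg (not_lt.mp hc) (by positivity)
    have h2 : 0 < 27 * C ^ 3 * ((d : ℝ) ^ 2 * Real.sqrt d) := by positivity
    linarith
  have hn0 : n ≠ 0 := by rintro rfl; simp at hnpos
  have hkey : C ^ 2 * d < 4 * n * ε ^ 2 := by
    have h1 : 27 / 2 * C ^ 2 * (d : ℝ) ^ 2 * ε ≤ 27 * C ^ 3 * ((d : ℝ) ^ 2 * Real.sqrt d) := by
      have : 27 / 2 * C ^ 2 * (d : ℝ) ^ 2 * ε
        ≤ 27 / 2 * C ^ 2 * (d : ℝ) ^ 2 * (2 * C * Real.sqrt d) := by gcongr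
      linarith
    have h2 : 27 / 2 * C ^ 2 * (d : ℝ) ^ 2 * ε < (8 * n * ε ^ 2) * ε := by linarith
    have h3 := lt_of_mul_lt_mul_right h2 hε.le
    have h4 : C ^ 2 * d * 1 ≤ C ^ 2 * d * d := by gcongr
    have h5 : 0 ≤ C ^ 2 * d := by positivity
    nlinarith
  set w : (Fin d → Fin (n + 1)) → ℝ := fun p =>
    ∏ i, (n.choose (p i) : ℝ) * x i ^ (p i : ℕ) * (1 - x i) ^ (n - (p i : ℕ)) with hw
  have hw0 : ∀ p, 0 ≤ w p := fun p => Finset.prod_nonneg fun i _ => by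
    have h1 := (hxi i).1
    have h2 : 0 ≤ 1 - x i := by linarith [(hxi i).2]
    positivity
  have hw1 : ∑ p, w p = 1 := aux_prob_multi d n x
  have hB : g x - bernsteinApprox d n g x
      = ∑ p : Fin d → Fin (n + 1), (g x - g (fun i => (p i : ℝ) / n)) * w p := by
    simp only [sub_mul, Finset.sum_sub_distrib, ← Finset.mul_sum, hw1, mul_one]
    rfl
  have hpt : ∀ p : Fin d → Fin (n + 1), |(g x - g (fun i => (p i : ℝ) / n)) * w p|
      ≤ C ^ 2 / (2 * ε) * ∑ i, (x i - (p i : ℝ) / n) ^ 2 * w p + ε / 2 * w p := by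
    intro p
    rw [abs_mul, abs_of_nonneg (hw0 p), ← Finset.sum_mul, ← mul_assoc, ← add_mul]
    refine mul_le_mul_of_nonneg_right ?_ (hw0 p)
    refine (hLip x hx _ ⟨fun i => ?_, fun i => ?_⟩).trans ?_
    · simp only [Pi.zero_apply]; positivity
    · simp only [Pi.one_apply]
      rw [div_le_one hnpos]
      exact_mod_cast Nat.lt_succ_iff.mp (p i).2
    · have hS : 0 ≤ ∑ i, (x i - (p i : ℝ) / n) ^ 2 := Finset.sum_nonneg fun i _ => sq_nonneg _
      have hq := Real.sq_sqrt hS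
      set r := Real.sqrt (∑ i, (x i - (p i : ℝ) / n) ^ 2)
      rw [← hq]
      have : C ^ 2 / (2 * ε) * r ^ 2 + ε / 2 - C * r = (C * r - ε) ^ 2 / (2 * ε) := by
        field_simp
        ring
      have h2 : 0 ≤ (C * r - ε) ^ 2 / (2 * ε) := by positivity
      linarith
  have hvar : ∑ p : Fin d → Fin (n + 1), ∑ i, (x i - (p i : ℝ) / n) ^ 2 * w p ≤ d / (4 * n) := by
    rw [Finset.sum_comm]
    have h1 : ∀ i ∈ (Finset.univ : Finset (Fin d)),
        ∑ p : Fin d → Fin (n + 1), (x i - (p i : ℝ) / n) ^ 2 * w p ≤ 1 / (4 * n) := by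
      intro i _
      rw [aux_var_multi d n hn0 x hxi i, div_le_div_iff₀ hnpos (by positivity)]
      nlinarith [sq_nonneg (2 * x i - 1)]
    refine (Finset.sum_le_sum h1).trans (le_of_eq ?_)
    simp
    ring
  rw [hB]
  calc |∑ p : Fin d → Fin (n + 1), (g x - g (fun i => (p i : ℝ) / n)) * w p|
      ≤ ∑ p : Fin d → Fin (n + 1), |(g x - g (fun i => (p i : ℝ) / n)) * w p| :=
        Finset.abs_sum_le_sum_abs _ _
    _ ≤ ∑ p : Fin d → Fin (n + 1),
        (C ^ 2 / (2 * ε) * ∑ i, (x i - (p i : ℝ) / n) ^ 2 * w p + ε / 2 * w p) :=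
        Finset.sum_le_sum fun p _ => hpt p
    _ = C ^ 2 / (2 * ε) * ∑ p : Fin d → Fin (n + 1), ∑ i, (x i - (p i : ℝ) / n) ^ 2 * w p
        + ε / 2 := by
        rw [Finset.sum_add_distrib, ← Finset.mul_sum, ← Finset.mul_sum, hw1, mul_one]
    _ ≤ C ^ 2 / (2 * ε) * (d / (4 * n)) + ε / 2 := by gcongr
    _ < ε := by
        have : C ^ 2 / (2 * ε) * (d / (4 * n)) < ε / 2 := by
          rw [div_mul_div_comm, div_lt_div_iff₀ (by positivity) (by norm_num)]
          nlinarith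
        linarith
end

section
/- Let d ≥ 1, n ≥ 1, δ > 0, and x ∈ [0,1]^d. Then Σ_{p ∈ S} ∏_{i=1}^d C(n,pᵢ) xᵢ^{pᵢ} (1 − xᵢ)^{n−pᵢ} ≤ (1 + 1/(4 n δ²))^d − 1, where S is the set of multi-indices p ∈ {0,…,n}^d for which there exists some i ∈ {1,…,d} with |pᵢ/n − xᵢ| ≥ δ, and C(n,p) is the binomial coefficient. -/
theorem bern_1d (n : ℕ) (hn : 1 ≤ n) (δ : ℝ) (x : unitInterval) :
    ∑ k : Fin (n + 1), bernstein n k x * (1 + ((k : ℝ) / n - x) ^ 2 / δ ^ 2)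
      = 1 + (x : ℝ) * (1 - x) / n / δ ^ 2 := by
  have h1 := bernstein.probability n x
  have h2 := bernstein.variance (n := n) (by omega) x
  simp only [mul_add, mul_one, Finset.sum_add_distrib, h1]
  rw [← h2, Finset.sum_div]
  congr 1
  refine Finset.sum_congr rfl fun k _ => ?_
  simp only [bernstein.z]
  ring

open Classical in
/-- Tail bound for multivariate Bernstein weights: the total Bernstein weight of the
multi-indices `p ∈ {0,…,n}^d` having some coordinate with `|pᵢ/n − xᵢ| ≥ δ` is at most
`(1 + 1/(4nδ²))^d − 1`. -/
theorem bernstein_tail_bound (d n : ℕ) (hd : 1 ≤ d) (hn : 1 ≤ n)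
    (δ : ℝ) (hδ : 0 < δ) (x : Fin d → ℝ) (hx : x ∈ Set.Icc (0 : Fin d → ℝ) 1) :
    ∑ p ∈ Finset.univ.filter
        (fun p : Fin d → Fin (n + 1) => ∃ i, δ ≤ |(p i : ℝ) / n - x i|),
      ∏ i, (n.choose (p i) : ℝ) * x i ^ (p i : ℕ) * (1 - x i) ^ (n - (p i : ℕ)) ≤
      (1 + 1 / (4 * n * δ ^ 2)) ^ d - 1 := by
  have hn0 : (0 : ℝ) < n := by exact_mod_cast hn
  let y : Fin d → unitInterval := fun i => ⟨x i, hx.1 i, hx.2 i⟩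
  have hy : ∀ p : Fin d → Fin (n + 1),
      ∏ i, (n.choose (p i) : ℝ) * x i ^ (p i : ℕ) * (1 - x i) ^ (n - (p i : ℕ))
        = ∏ i, bernstein n (p i) (y i) := fun p =>
    Finset.prod_congr rfl fun i _ => (bernstein_apply n (p i) (y i)).symm
  simp only [hy]
  let t : Fin d → Fin (n + 1) → ℝ := fun i k => ((k : ℝ) / n - y i) ^ 2 / δ ^ 2
  have ht : ∀ i k, 0 ≤ t i k := fun i k => by positivity
  have hw : ∀ p : Fin d → Fin (n + 1), 0 ≤ ∏ i, bernstein n (p i) (y i) := fun p =>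
    Finset.prod_nonneg fun i _ => bernstein_nonneg
  have key : ∀ p : Fin d → Fin (n + 1), ∀ i, 1 + t i (p i) ≤ ∏ j, (1 + t j (p j)) := by
    intro p i
    rw [← Finset.mul_prod_erase Finset.univ _ (Finset.mem_univ i)]
    refine le_mul_of_one_le_right (by linarith [ht i (p i)]) ?_
    have := Finset.prod_le_prod (s := Finset.univ.erase i) (f := fun _ => (1 : ℝ))
      (g := fun j => 1 + t j (p j)) (fun _ _ => zero_le_one)
      (fun j _ => by linarith [ht j (p j)])
    simpa using this
  have e1 : ∑ p : Fin d → Fin (n + 1), ∏ i, bernstein n (p i) (y i) = 1 := by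
    rw [← Fintype.piFinset_univ, ← Finset.prod_univ_sum (fun _ => Finset.univ)
      (fun i k => bernstein n (k : Fin (n + 1)) (y i))]
    simp
  have e2 : ∑ p : Fin d → Fin (n + 1), ∏ i, (bernstein n (p i) (y i) * (1 + t i (p i)))
      = ∏ i, (1 + (y i : ℝ) * (1 - y i) / n / δ ^ 2) := by
    rw [← Fintype.piFinset_univ, ← Finset.prod_univ_sum (fun _ => Finset.univ)
      (fun i k => bernstein n (k : Fin (n + 1)) (y i) * (1 + t i k))]
    exact Finset.prod_congr rfl fun i _ => bern_1d n hn δ (y i)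
  have e3 : ∏ i, (1 + (y i : ℝ) * (1 - y i) / n / δ ^ 2) ≤ (1 + 1 / (4 * n * δ ^ 2)) ^ d := by
    have : (1 + 1 / (4 * n * δ ^ 2)) ^ d = ∏ i : Fin d, (1 + 1 / (4 * n * δ ^ 2)) := by simp
    rw [this]
    refine Finset.prod_le_prod (fun i _ => ?_) fun i _ => ?_
    · have h0 := (y i).2.1
      have h1 : 0 ≤ 1 - (y i : ℝ) := sub_nonneg.2 (y i).2.2
      positivity
    · have : 1 / (4 * n * δ ^ 2) = (1 / 4) / n / δ ^ 2 := by field_simp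
      rw [this]
      gcongr
      nlinarith [sq_nonneg ((y i : ℝ) - 1 / 2)]
  calc _ ≤ ∑ p ∈ Finset.univ.filter
        (fun p : Fin d → Fin (n + 1) => ∃ i, δ ≤ |(p i : ℝ) / n - x i|),
        (∏ i, (bernstein n (p i) (y i) * (1 + t i (p i))) - ∏ i, bernstein n (p i) (y i)) := by
        refine Finset.sum_le_sum fun p hp => ?_
        obtain ⟨i, hi⟩ := (Finset.mem_filter.1 hp).2
        have h1 : 1 ≤ t i (p i) := by
          show 1 ≤ ((p i : ℝ) / n - x i) ^ 2 / δ ^ 2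
          rw [one_le_div (by positivity), ← sq_abs ((p i : ℝ) / n - x i)]
          gcongr
        rw [Finset.prod_mul_distrib]
        nlinarith [key p i, hw p]
    _ ≤ ∑ p : Fin d → Fin (n + 1),
        (∏ i, (bernstein n (p i) (y i) * (1 + t i (p i))) - ∏ i, bernstein n (p i) (y i)) := by
        refine Finset.sum_le_sum_of_subset_of_nonneg (Finset.filter_subset _ _) fun p _ _ => ?_
        rw [Finset.prod_mul_distrib]
        nlinarith [key p ⟨0, hd⟩, hw p, ht ⟨0, hd⟩ (p ⟨0, hd⟩)]
    _ ≤ _ := by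
        rw [Finset.sum_sub_distrib, e1, e2]
        linarith
end
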